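/- arXiv:2104.09588 — 2 statements merged into one kernel-verified Lean document; each statement's English description precedes it below -/
import Mathlib

section
/- Let Φ be an N-function with derivative φ satisfying Φ(2t) ≈ Φ(t) for t ∈ ℝ_+, and let u be a weight on ℝ_+ with ∫_{ℝ_+} u = ∞; set U(x) = ∫_0^x u. Suppose there is c > 0, independent of λ, x ∈ ℝ_+, such that (i) φ( c α(λ,x)/λ ) U(x) ≤ c^{-1} λ, where α(λ,x) = ∫_x^∞ Φ(λ/U(y)) u(y) dy, and (ii) ∫_0^x φ^{-1}( (c β(λ,x)/λ) · (y/U(y)) ) · (y u(y)/U(y)) dy ≤ c^{-1} λ, where β(λ,x) = ∫_x^∞ Φ(λ/y) u(y) dy. Then there is C > 0 such that ρ_{Φ,u}( t ↦ t^{-1}∫_0^t f* ) ≤ C ρ_{Φ,u}(f*) for all f ∈ M_+(ℝ_+). -/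
open MeasureTheory Set
open scoped ENNReal

noncomputable section

/-- The positive integral operator `T_K` on `ℝ₊`. -/
def TK (K : ℝ → ℝ → ℝ≥0∞) (f : ℝ → ℝ≥0∞) (x : ℝ) : ℝ≥0∞ :=
  ∫⁻ y in Ioi (0:ℝ), K x y * f y

/-- Distribution function `μ_f(λ) = |{x ∈ ℝ₊ : f x > λ}|`. -/
def distrib (f : ℝ → ℝ≥0∞) (l : ℝ≥0∞) : ℝ≥0∞ :=
  volume {x : ℝ | 0 < x ∧ l < f x}

/-- Nonincreasing rearrangement `f*(t) = inf{λ : μ_f(λ) ≤ t}`. -/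
def rearr (f : ℝ → ℝ≥0∞) (t : ℝ) : ℝ≥0∞ :=
  sInf {l : ℝ≥0∞ | distrib f l ≤ ENNReal.ofReal t}

/-- Extension of a real function to `ℝ≥0∞`. -/
def extE (F : ℝ → ℝ) (a : ℝ≥0∞) : ℝ≥0∞ :=
  if a = ⊤ then ⊤ else ENNReal.ofReal (F a.toReal)

/-- Orlicz–Lorentz gauge functional `ρ_{Φ,u}`. -/
def ogauge (F : ℝ → ℝ) (u : ℝ → ℝ) (f : ℝ → ℝ≥0∞) : ℝ≥0∞ :=
  sInf {l : ℝ≥0∞ | 0 < l ∧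
    (∫⁻ x in Ioi (0:ℝ), extE F (f x / l) * ENNReal.ofReal (u x)) ≤ 1}

/-- `F` is an N-function with density `φ`: `F x = ∫_0^x φ`, `φ` increasing from `ℝ₊` onto `ℝ₊`. -/
def IsNFunction (F φ : ℝ → ℝ) : Prop :=
  StrictMonoOn φ (Ioi 0) ∧ MapsTo φ (Ioi 0) (Ioi 0) ∧ SurjOn φ (Ioi 0) (Ioi 0) ∧
    ∀ x : ℝ, 0 ≤ x → F x = ∫ y in (0:ℝ)..x, φ y

/-- `F(2t) ≈ F(t)` on `ℝ₊`. -/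
def Doubling (F : ℝ → ℝ) : Prop := ∃ C > 0, ∀ t > 0, F (2 * t) ≤ C * F t

/-- A weight: nonnegative, measurable, locally integrable on `ℝ₊`. -/
def IsWeight (u : ℝ → ℝ) : Prop :=
  Measurable u ∧ (∀ x, 0 ≤ u x) ∧ LocallyIntegrableOn u (Ioi 0)

/-- `U(x) = ∫_0^x u`. -/
def Uw (u : ℝ → ℝ) (x : ℝ) : ℝ := ∫ t in (0:ℝ)..x, u t

/-- `Ψ` (with density `ψ`) is the complementary N-function of the N-function `Φ`
(with density `φ`), i.e. `ψ = φ⁻¹` and `Ψ t = ∫_0^t φ⁻¹`. -/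
def IsComplementary (F φ G ψ : ℝ → ℝ) : Prop :=
  IsNFunction F φ ∧ IsNFunction G ψ ∧ InvOn ψ φ (Ioi 0) (Ioi 0)

/-- `g` is the inverse of `f` on `[0,∞)`. -/
def IsInverseOn (g f : ℝ → ℝ) : Prop :=
  (∀ x ≥ 0, g (f x) = x) ∧ (∀ y ≥ 0, f (g y) = y)

/-- Iterated rearrangement `L(t,s) = (K^{*₂})^{*₁}(t,s)`. -/
def iterRearr (K : ℝ → ℝ → ℝ≥0∞) (t s : ℝ) : ℝ≥0∞ :=
  rearr (fun x => rearr (fun y => K x y) s) t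

/-- `α(λ,x) = ∫_x^∞ Φ(λ/U(y)) u(y) dy`. -/
def hardyAlpha (F : ℝ → ℝ) (u : ℝ → ℝ) (lam x : ℝ) : ℝ≥0∞ :=
  ∫⁻ y in Ioi x, extE F (ENNReal.ofReal lam / ENNReal.ofReal (Uw u y)) * ENNReal.ofReal (u y)

/-- `β(λ,x) = ∫_x^∞ Φ(λ/y) u(y) dy`. -/
def hardyBeta (F : ℝ → ℝ) (u : ℝ → ℝ) (lam x : ℝ) : ℝ≥0∞ :=
  ∫⁻ y in Ioi x, ENNReal.ofReal (F (lam / y)) * ENNReal.ofReal (u y)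

/-- The Hardy-averaging conditions (14)–(15) for an N-function `Φ` (density `φ`,
inverse density `ψ = φ⁻¹`) and weight `u`. -/
def HardyConditions (F φ ψ u : ℝ → ℝ) : Prop :=
  ∃ c > 0, (∀ lam > 0, ∀ x > 0,
      extE φ (ENNReal.ofReal c * hardyAlpha F u lam x / ENNReal.ofReal lam) *
        ENNReal.ofReal (Uw u x) ≤ ENNReal.ofReal (lam / c)) ∧
    (∀ lam > 0, ∀ x > 0,
      (∫⁻ y in Ioo (0:ℝ) x,
        extE ψ ((ENNReal.ofReal c * hardyBeta F u lam x / ENNReal.ofReal lam) *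
          ENNReal.ofReal (y / Uw u y)) * ENNReal.ofReal (y * u y / Uw u y))
        ≤ ENNReal.ofReal (lam / c))


namespace IsNFunction

variable {Φ φ ψ : ℝ → ℝ}

lemma intervalIntegrable (hΦ : IsNFunction Φ φ) {a b : ℝ} (ha : 0 ≤ a) (hab : a ≤ b) :
    IntervalIntegrable φ volume a b := by
  have hmono : Monotone ((Ioi (0:ℝ)).indicator φ) := by
    intro x y hxy
    by_cases hx : x ∈ Ioi (0:ℝ)
    · have hy : y ∈ Ioi (0:ℝ) := lt_of_lt_of_le hx hxy
      simpa [hx, hy] using hΦ.1.monotoneOn hx hy hxy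
    · rw [indicator_of_notMem hx]
      exact indicator_nonneg (fun z hz => (hΦ.2.1 hz).le) y
  refine (hmono.intervalIntegrable (μ := volume) (a := a) (b := b)).congr ?_
  rw [uIoc_of_le hab]
  intro x hx
  exact indicator_of_mem (lt_of_le_of_lt ha hx.1) φ

lemma sub_eq (hΦ : IsNFunction Φ φ) {a b : ℝ} (ha : 0 ≤ a) (hab : a ≤ b) :
    Φ b - Φ a = ∫ y in a..b, φ y := by
  rw [hΦ.2.2.2 a ha, hΦ.2.2.2 b (ha.trans hab)]
  exact intervalIntegral.integral_interval_sub_left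
    (hΦ.intervalIntegrable le_rfl (ha.trans hab)) (hΦ.intervalIntegrable le_rfl ha)

lemma map_zero (hΦ : IsNFunction Φ φ) : Φ 0 = 0 := by
  simpa using hΦ.2.2.2 0 le_rfl

lemma mul_le_sub (hΦ : IsNFunction Φ φ) {a b : ℝ} (ha : 0 < a) (hab : a ≤ b) :
    (b - a) * φ a ≤ Φ b - Φ a := by
  rw [hΦ.sub_eq ha.le hab]
  have := intervalIntegral.integral_mono_on_of_le_Ioo (f := fun _ => φ a) (g := φ) hab
    intervalIntegrable_const (hΦ.intervalIntegrable ha.le hab)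
    (fun x hx => hΦ.1.monotoneOn ha (ha.trans hx.1) hx.1.le)
  simpa using this

lemma sub_le_mul (hΦ : IsNFunction Φ φ) {a b : ℝ} (ha : 0 ≤ a) (hab : a ≤ b) :
    Φ b - Φ a ≤ (b - a) * φ b := by
  rcases hab.eq_or_lt with rfl | hab
  · simp
  rw [hΦ.sub_eq ha hab.le]
  have := intervalIntegral.integral_mono_on_of_le_Ioo (f := φ) (g := fun _ => φ b) hab.le
    (hΦ.intervalIntegrable ha hab.le) intervalIntegrable_const
    (fun x hx => hΦ.1.monotoneOn (ha.trans_lt hx.1) (ha.trans_lt hab) hx.2.le)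
  simpa using this

lemma monotoneOn (hΦ : IsNFunction Φ φ) : MonotoneOn Φ (Ici 0) := by
  intro a ha b hb hab
  rcases (mem_Ici.1 ha).eq_or_lt with rfl | ha'
  · rw [hΦ.map_zero, hΦ.2.2.2 b hb]
    exact intervalIntegral.integral_nonneg_of_ae_restrict hb (by
      refine (ae_restrict_iff' measurableSet_Icc).2 ?_
      filter_upwards [compl_mem_ae_iff.2 (measure_singleton (μ := volume) (0:ℝ))] with x hx hx'
      exact (hΦ.2.1 (lt_of_le_of_ne hx'.1 (Ne.symm hx))).le)
  · have h := hΦ.mul_le_sub ha' hab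
    nlinarith [mul_nonneg (sub_nonneg.2 hab) (mem_Ioi.1 (hΦ.2.1 ha')).le]

lemma pos (hΦ : IsNFunction Φ φ) {t : ℝ} (ht : 0 < t) : 0 < Φ t := by
  have h := hΦ.mul_le_sub (half_pos ht) (half_le_self ht.le)
  have h0 := hΦ.monotoneOn (mem_Ici.2 le_rfl) (mem_Ici.2 (half_pos ht).le) (half_pos ht).le
  rw [hΦ.map_zero] at h0
  have := mul_pos (half_pos ht) (mem_Ioi.1 (hΦ.2.1 (half_pos ht)))
  nlinarith

lemma two_mul_le (hΦ : IsNFunction Φ φ) {t : ℝ} (ht : 0 ≤ t) : 2 * Φ t ≤ Φ (2 * t) := by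
  rcases ht.eq_or_lt with rfl | ht
  · simp [hΦ.map_zero]
  · have h1 := hΦ.mul_le_sub ht (b := 2 * t) (by linarith)
    have h2 := hΦ.sub_le_mul le_rfl ht.le
    rw [hΦ.map_zero] at h2
    nlinarith

lemma inv_pos (hΦ : IsNFunction Φ φ) (hψ : InvOn ψ φ (Ioi 0) (Ioi 0)) {b : ℝ} (hb : 0 < b) :
    0 < ψ b := by
  obtain ⟨x, hx, rfl⟩ := hΦ.2.2.1 hb
  rw [hψ.1 hx]
  exact hx

lemma inv_mono (hΦ : IsNFunction Φ φ) (hψ : InvOn ψ φ (Ioi 0) (Ioi 0)) {a b : ℝ} (ha : 0 < a)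
    (hab : a ≤ b) : ψ a ≤ ψ b := by
  by_contra! h
  have := hΦ.1 (hΦ.inv_pos hψ (ha.trans_le hab)) (hΦ.inv_pos hψ ha) h
  rw [hψ.2 ha, hψ.2 (ha.trans_le hab)] at this
  linarith

lemma young (hΦ : IsNFunction Φ φ) (hψ : InvOn ψ φ (Ioi 0) (Ioi 0)) {a b : ℝ} (ha : 0 ≤ a)
    (hb : 0 < b) : a * b ≤ Φ a + b * ψ b := by
  have hp := hΦ.inv_pos hψ hb
  have hφ : φ (ψ b) = b := hψ.2 hb
  have h0 := hΦ.monotoneOn (mem_Ici.2 le_rfl) (mem_Ici.2 ha) ha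
  have h1 := hΦ.monotoneOn (mem_Ici.2 le_rfl) (mem_Ici.2 hp.le) hp.le
  rw [hΦ.map_zero] at h0 h1
  rcases le_total a (ψ b) with h | h
  · nlinarith
  · have := hΦ.mul_le_sub hp h
    rw [hφ] at this
    nlinarith

lemma extE_monotone (hΦ : IsNFunction Φ φ) : Monotone (extE Φ) := by
  intro a b hab
  unfold extE
  by_cases hb : b = ⊤
  · simp [hb]
  · have ha : a ≠ ⊤ := ne_top_of_le_ne_top hb hab
    simp only [ha, hb, if_false]
    exact ENNReal.ofReal_le_ofReal (hΦ.monotoneOn ENNReal.toReal_nonneg ENNReal.toReal_nonneg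
      (ENNReal.toReal_mono hb hab))

lemma extE_zero (hΦ : IsNFunction Φ φ) : extE Φ 0 = 0 := by
  simp [extE, hΦ.map_zero]

lemma two_mul_extE_le (hΦ : IsNFunction Φ φ) (a : ℝ≥0∞) : 2 * extE Φ a ≤ extE Φ (2 * a) := by
  unfold extE
  by_cases ha : a = ⊤
  · simp [ha, ENNReal.mul_top]
  · have h2 : 2 * a ≠ ⊤ := ENNReal.mul_ne_top (by simp) ha
    simp only [ha, h2, if_false]
    rw [show (2 : ℝ≥0∞) = ENNReal.ofReal 2 by simp, ← ENNReal.ofReal_mul (by norm_num)]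
    refine ENNReal.ofReal_le_ofReal ?_
    rw [ENNReal.toReal_mul]
    simpa using hΦ.two_mul_le (t := a.toReal) ENNReal.toReal_nonneg

lemma extE_add_le (hΦ : IsNFunction Φ φ) (a b : ℝ≥0∞) :
    extE Φ (a + b) ≤ extE Φ (2 * a) + extE Φ (2 * b) := by
  rcases le_total a b with h | h
  · refine le_add_left (hΦ.extE_monotone ?_)
    rw [two_mul]
    gcongr
  · refine le_add_right (hΦ.extE_monotone ?_)
    rw [two_mul]
    gcongr

lemma extE_young (hΦ : IsNFunction Φ φ) (hψ : InvOn ψ φ (Ioi 0) (Ioi 0)) (a : ℝ≥0∞)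
    {b : ℝ≥0∞} (hb : b ≠ ⊤) : a * b ≤ extE Φ a + b * extE ψ b := by
  rcases eq_or_ne b 0 with rfl | hb0
  · simp
  by_cases ha : a = ⊤
  · simp [ha, extE]
  have hbp := ENNReal.toReal_pos hb0 hb
  have h := hΦ.young hψ (a := a.toReal) ENNReal.toReal_nonneg hbp
  simp only [extE, ha, hb, if_false]
  calc a * b = ENNReal.ofReal (a.toReal * b.toReal) := by
        rw [ENNReal.ofReal_mul ENNReal.toReal_nonneg, ENNReal.ofReal_toReal ha,
          ENNReal.ofReal_toReal hb]
    _ ≤ ENNReal.ofReal (Φ a.toReal + b.toReal * ψ b.toReal) := ENNReal.ofReal_le_ofReal h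
    _ ≤ ENNReal.ofReal (Φ a.toReal) + ENNReal.ofReal (b.toReal * ψ b.toReal) :=
        ENNReal.ofReal_add_le
    _ = _ := by rw [ENNReal.ofReal_mul ENNReal.toReal_nonneg, ENNReal.ofReal_toReal hb]

lemma ofReal_le_extE_inv (hΦ : IsNFunction Φ φ) (hψ : InvOn ψ φ (Ioi 0) (Ioi 0)) {b : ℝ}
    (hb : 0 < b) {s : ℝ≥0∞} (hs : ENNReal.ofReal b ≤ s) : ENNReal.ofReal (ψ b) ≤ extE ψ s := by
  unfold extE
  split_ifs with h
  · exact le_top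
  · exact ENNReal.ofReal_le_ofReal (hΦ.inv_mono hψ hb ((ENNReal.ofReal_le_iff_le_toReal h).1 hs))

end IsNFunction

section CumulativeMeasure

variable {ν : Measure ℝ}

lemma continuous_measure_Iic [NullSingletonClass ν] (hfin : ∀ y, ν (Iic y) ≠ ⊤) :
    Continuous fun y => ν (Iic y) := by
  have hloc : IsLocallyFiniteMeasure ν :=
    ⟨fun x => ⟨Iic (x + 1), Iic_mem_nhds (by linarith), (hfin _).lt_top⟩⟩
  have hc := intervalIntegral.continuous_primitive (μ := ν) (f := fun _ => (1:ℝ))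
    (fun a b => intervalIntegrable_const) 0
  have heq : (fun y => ν (Iic y)) =
      fun y => ENNReal.ofReal ((∫ _ in (0:ℝ)..y, (1:ℝ) ∂ν) + ν.real (Iic 0)) := by
    ext y
    rw [intervalIntegral.integral_const', ← ENNReal.ofReal_toReal (hfin y)]
    congr 1
    rcases le_total 0 y with h | h
    · have := measureReal_union (μ := ν) (Iic_disjoint_Ioc (a := 0) (b := 0) (c := y) le_rfl)
        measurableSet_Ioc (hfin 0) (ne_top_of_le_ne_top (hfin y) (measure_mono Ioc_subset_Iic_self))
      rw [Iic_union_Ioc_eq_Iic h] at this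
      rw [Ioc_eq_empty_of_le h]
      simp only [measureReal_empty, smul_eq_mul]
      rw [← measureReal_def, this]
      ring
    · have := measureReal_union (μ := ν) (Iic_disjoint_Ioc (a := y) (b := y) (c := 0) le_rfl)
        measurableSet_Ioc (hfin y) (ne_top_of_le_ne_top (hfin 0) (measure_mono Ioc_subset_Iic_self))
      rw [Iic_union_Ioc_eq_Iic h] at this
      rw [Ioc_eq_empty_of_le h]
      simp only [measureReal_empty, smul_eq_mul]
      rw [← measureReal_def, this]
      ring
  rw [heq]
  exact ENNReal.continuous_ofReal.comp (hc.add continuous_const)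

lemma monotone_measure_Iic : Monotone fun y => ν (Iic y) :=
  fun _ _ h => measure_mono (Iic_subset_Iic.2 h)

lemma exists_setOf_measure_Iic_le_eq [NullSingletonClass ν] (h0 : ν (Iic 0) = 0)
    (hfin : ∀ y, ν (Iic y) ≠ ⊤) {v : ℝ≥0∞} (hv : ∃ b, v < ν (Iic b)) :
    ∃ x, 0 ≤ x ∧ ν (Iic x) = v ∧ {y | ν (Iic y) ≤ v} = Iic x := by
  have hc := continuous_measure_Iic hfin
  obtain ⟨b, hb⟩ := hv
  have hcl : IsClosed {y | ν (Iic y) ≤ v} := isClosed_le hc continuous_const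
  have h0m : (0:ℝ) ∈ {y | ν (Iic y) ≤ v} := by simp [h0]
  have hbd : BddAbove {y | ν (Iic y) ≤ v} := by
    refine ⟨b, fun y hy => ?_⟩
    by_contra! h
    exact absurd (hb.trans_le ((monotone_measure_Iic h.le).trans hy)) (lt_irrefl _)
  have hmem := hcl.csSup_mem ⟨0, h0m⟩ hbd
  refine ⟨sSup {y | ν (Iic y) ≤ v}, le_csSup hbd h0m, le_antisymm hmem ?_, ?_⟩
  · obtain ⟨z, hz⟩ := mem_range_of_exists_le_of_exists_ge hc ⟨0, h0m⟩ ⟨b, hb.le⟩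
    simp only at hz
    calc v = ν (Iic z) := hz.symm
      _ ≤ _ := monotone_measure_Iic (le_csSup hbd hz.le)
  · ext y
    exact ⟨fun hy => le_csSup hbd hy, fun hy => (monotone_measure_Iic hy).trans hmem⟩

lemma exists_map_eq_two_smul [NullSingletonClass ν] (h0 : ν (Iic 0) = 0)
    (hfin : ∀ y, ν (Iic y) ≠ ⊤) (htop : ν univ = ⊤) :
    ∃ τ : ℝ → ℝ, Measurable τ ∧ (∀ y x, τ y ≤ x ↔ 0 ≤ x ∧ ν (Iic y) ≤ 2 * ν (Iic x)) ∧
      ν.map τ = (2 : ℝ≥0∞) • ν := by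
  have hc := continuous_measure_Iic hfin
  have hc2 : Continuous fun x => 2 * ν (Iic x) :=
    (ENNReal.continuous_const_mul (by simp)).comp hc
  have hbig : ∀ v : ℝ≥0∞, v ≠ ⊤ → ∃ b, v < ν (Iic b) := fun v hv =>
    ((tendsto_order.1 (htop ▸ tendsto_measure_Iic_atTop ν)).1 v hv.lt_top).exists
  have hτ : ∀ y, ∃ t, ∀ x, t ≤ x ↔ 0 ≤ x ∧ ν (Iic y) ≤ 2 * ν (Iic x) := by
    intro y
    set S := {x | 0 ≤ x ∧ ν (Iic y) ≤ 2 * ν (Iic x)} with hS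
    have hbd : BddBelow S := ⟨0, fun x hx => hx.1⟩
    have hcl : IsClosed S := isClosed_Ici.inter (isClosed_le continuous_const hc2)
    have hne : S.Nonempty := by
      refine ⟨max y 0, le_max_right _ _, ?_⟩
      calc ν (Iic y) ≤ ν (Iic (max y 0)) := monotone_measure_Iic (le_max_left _ _)
        _ ≤ _ := le_mul_of_one_le_left' one_le_two
    have hmem := hcl.csInf_mem hne hbd
    refine ⟨sInf S, fun x => ⟨fun h => ⟨hmem.1.trans h, hmem.2.trans ?_⟩, fun h => csInf_le hbd h⟩⟩
    gcongr
  choose τ hτ using hτ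
  have hpre : ∀ x, 0 ≤ x → τ ⁻¹' Iic x = {y | ν (Iic y) ≤ 2 * ν (Iic x)} := by
    intro x hx
    ext y
    simp [hτ, hx]
  have hm : Measurable τ := by
    refine measurable_of_Iic fun x => ?_
    rcases le_or_gt 0 x with hx | hx
    · rw [hpre x hx]
      exact (isClosed_le hc continuous_const).measurableSet
    · convert MeasurableSet.empty
      ext y
      simp [hτ, hx]
  have hIic : ∀ x, ν (τ ⁻¹' Iic x) = 2 * ν (Iic x) := by
    intro x
    rcases le_or_gt 0 x with hx | hx
    · rw [hpre x hx]
      obtain ⟨z, -, hz, hs⟩ := exists_setOf_measure_Iic_le_eq h0 hfin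
        (hbig (2 * ν (Iic x)) (ENNReal.mul_ne_top (by simp) (hfin x)))
      rw [hs, hz]
    · have h1 : τ ⁻¹' Iic x = ∅ := by
        ext y
        simp [hτ, hx]
      have h2 : ν (Iic x) = 0 := le_antisymm (h0 ▸ monotone_measure_Iic hx.le) zero_le
      simp [h1, h2]
  have hloc : IsLocallyFiniteMeasure (ν.map τ) := by
    refine ⟨fun x => ⟨Iic (x + 1), Iic_mem_nhds (by linarith), ?_⟩⟩
    rw [Measure.map_apply hm measurableSet_Iic, hIic]
    exact ENNReal.mul_lt_top (by simp) (hfin _).lt_top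
  refine ⟨τ, hm, hτ, Measure.ext_of_Ioc _ _ fun a b hab => ?_⟩
  rw [Measure.map_apply hm measurableSet_Ioc, ← Iic_sdiff_Iic, preimage_sdiff,
    measure_sdiff (preimage_mono (Iic_subset_Iic.2 hab.le)) (hm measurableSet_Iic).nullMeasurableSet
      (by rw [hIic]; exact ENNReal.mul_ne_top (by simp) (hfin a)), hIic, hIic,
    Measure.smul_apply, measure_sdiff (Iic_subset_Iic.2 hab.le) measurableSet_Iic.nullMeasurableSet
      (hfin a), smul_eq_mul, ENNReal.mul_sub (by simp)]

end CumulativeMeasure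

section Hardy

variable {ν : Measure ℝ} {Φ φ ψ : ℝ → ℝ} {W h : ℝ → ℝ≥0∞}

lemma mul_setLIntegral_le_modular_add (hΦ : IsNFunction Φ φ) (hψ : InvOn ψ φ (Ioi 0) (Ioi 0))
    (hWtop : ∀ y, W y ≠ ⊤) (hh : Measurable h) {B K : ℝ≥0∞} (hB : B ≠ ⊤) {E : Set ℝ} {x : ℝ}
    (hEx : E ⊆ Iic x) (hK : ∫⁻ y in Iic x, W y * extE ψ (B * W y) ∂ν ≤ K) :
    B * ∫⁻ y in E, h y * W y ∂ν ≤ (∫⁻ y in E, extE Φ (h y) ∂ν) + B * K := by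
  calc B * ∫⁻ y in E, h y * W y ∂ν = ∫⁻ y in E, B * (h y * W y) ∂ν :=
        (lintegral_const_mul' _ _ hB).symm
    _ ≤ ∫⁻ y in E, (extE Φ (h y) + B * (W y * extE ψ (B * W y))) ∂ν := by
        refine lintegral_mono fun y => ?_
        have := hΦ.extE_young hψ (h y) (ENNReal.mul_ne_top hB (hWtop y))
        calc B * (h y * W y) = h y * (B * W y) := by ring
          _ ≤ _ := this
          _ = _ := by ring
    _ = (∫⁻ y in E, extE Φ (h y) ∂ν) + B * ∫⁻ y in E, W y * extE ψ (B * W y) ∂ν := by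
        have hm : Measurable fun y => extE Φ (h y) := hΦ.extE_monotone.measurable.comp hh
        rw [lintegral_add_left hm, lintegral_const_mul' _ _ hB]
    _ ≤ _ := by
        gcongr
        exact (lintegral_mono_set hEx).trans hK

theorem modular_hardy_le [NullSingletonClass ν] (hΦ : IsNFunction Φ φ)
    (hψ : InvOn ψ φ (Ioi 0) (Ioi 0)) (h0 : ν (Iic 0) = 0)
    (hWtop : ∀ y, W y ≠ ⊤) (hh : Measurable h) {c : ℝ} (hc : 0 < c) (β : ℝ → ℝ → ℝ≥0∞)
    (hβ : ∀ l x, β l x = ∫⁻ y in Ioi x, extE Φ (ENNReal.ofReal l / ENNReal.ofReal y) ∂ν)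
    (hβ0 : ∀ l > 0, ∀ x > 0, β l x ≠ 0) (hβtop : ∀ l > 0, ∀ x > 0, β l x ≠ ⊤)
    (hcond : ∀ l > 0, ∀ x > 0,
      ∫⁻ y in Iic x, W y * extE ψ (β l x * ENNReal.ofReal (c / l) * W y) ∂ν
        ≤ ENNReal.ofReal (l / c)) :
    ∫⁻ y, extE Φ (ENNReal.ofReal (c / 8) * (∫⁻ z in Iic y, h z * W z ∂ν) / ENNReal.ofReal y) ∂ν
      ≤ ∫⁻ y, extE Φ (h y) ∂ν := by
  by_cases hfinh : ∫⁻ y, extE Φ (h y) ∂ν = ⊤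
  · simp [hfinh]
  have hkey : ∀ l > 0, ∀ x > 0, ∀ E ⊆ Iic x,
      β l x * ENNReal.ofReal (c / l) * ∫⁻ y in E, h y * W y ∂ν ≤
        (∫⁻ y in E, extE Φ (h y) ∂ν) + β l x := by
    intro l hl x hx E hE
    have := mul_setLIntegral_le_modular_add hΦ hψ hWtop hh
      (ENNReal.mul_ne_top (hβtop l hl x hx) ENNReal.ofReal_ne_top) hE (hcond l hl x hx)
    rwa [mul_assoc (β l x) _ (ENNReal.ofReal (l / c)), ← ENNReal.ofReal_mul (by positivity),
      show c / l * (l / c) = 1 by field_simp, ENNReal.ofReal_one, mul_one] at this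
  set κ := ν.withDensity (fun z => h z * W z) with hκ
  have hκE : ∀ E, MeasurableSet E → κ E = ∫⁻ y in E, h y * W y ∂ν := fun E hE =>
    withDensity_apply _ hE
  have hκna : NullSingletonClass κ :=
    ⟨fun x => withDensity_absolutelyContinuous _ _ (measure_singleton x)⟩
  have hκ0 : κ (Iic 0) = 0 := withDensity_absolutelyContinuous _ _ h0
  have hκfin : ∀ y, κ (Iic y) ≠ ⊤ := by
    have hpos : ∀ y > 0, κ (Iic y) ≠ ⊤ := by
      intro y hy htop
      have := hkey 1 one_pos y hy (Iic y) subset_rfl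
      rw [← hκE _ measurableSet_Iic, htop, ENNReal.mul_top] at this
      · refine absurd (top_le_iff.1 this) (ENNReal.add_ne_top.2 ⟨?_, hβtop 1 one_pos y hy⟩)
        exact ne_top_of_le_ne_top hfinh (setLIntegral_le_lintegral _ _)
      · exact mul_ne_zero (hβ0 1 one_pos y hy) (by simpa using hc)
    intro y
    exact ne_top_of_le_ne_top (hpos (max y 1) (by positivity))
      (monotone_measure_Iic (le_max_left _ _))
  have hcont := continuous_measure_Iic hκfin
  set E : ℤ → Set ℝ := fun k =>
    {y | ENNReal.ofReal ((2:ℝ) ^ k) < κ (Iic y) ∧ κ (Iic y) ≤ ENNReal.ofReal ((2:ℝ) ^ (k + 1))}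
    with hE
  have hEm : ∀ k, MeasurableSet (E k) := fun k =>
    (measurableSet_lt measurable_const hcont.measurable).inter
      (measurableSet_le hcont.measurable measurable_const)
  have hEd : Pairwise (Function.onFun Disjoint E) := by
    have : ∀ j k : ℤ, j < k → Disjoint (E j) (E k) := by
      intro j k hjk
      refine disjoint_left.2 fun y hy hy' => absurd (hy'.1.trans_le hy.2) (not_lt.2 ?_)
      exact ENNReal.ofReal_le_ofReal (zpow_le_zpow_right₀ one_le_two (by omega))
    intro j k hjk
    rcases lt_or_gt_of_ne hjk with h | h
    · exact this j k h
    · exact (this k j h).symm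
  have hstep : ∀ k, ∫⁻ y in E (k + 1), extE Φ (ENNReal.ofReal (c / 8) * κ (Iic y) /
      ENNReal.ofReal y) ∂ν ≤ ∫⁻ y in E k, extE Φ (h y) ∂ν := by
    intro k
    rcases (E (k + 1)).eq_empty_or_nonempty with hem | ⟨b, hb⟩
    · simp [hem]
    have h2k : (0:ℝ) < 2 ^ k := by positivity
    have hk1 : (2:ℝ) ^ (k + 1) = 2 * 2 ^ k := by rw [zpow_add_one₀ two_ne_zero]; ring
    have hk2 : (2:ℝ) ^ (k + 1 + 1) = 4 * 2 ^ k := by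
      rw [zpow_add_one₀ two_ne_zero, hk1]; ring
    obtain ⟨x, hx0, hx, hxs⟩ := exists_setOf_measure_Iic_le_eq hκ0 hκfin ⟨b, hb.1⟩
    obtain ⟨x', -, hx', hxs'⟩ := exists_setOf_measure_Iic_le_eq hκ0 hκfin
      (v := ENNReal.ofReal ((2:ℝ) ^ k)) ⟨b, lt_of_le_of_lt (ENNReal.ofReal_le_ofReal
        (by rw [hk1]; linarith)) hb.1⟩
    have hxpos : 0 < x := by
      refine lt_of_le_of_ne hx0 ?_
      rintro rfl
      rw [hκ0, eq_comm, ENNReal.ofReal_eq_zero] at hx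
      rw [hk1] at hx
      linarith
    have hEk : E k = Iic x \ Iic x' := by
      rw [← hxs, ← hxs']
      ext y
      simp [hE, and_comm]
    have hxx : x' ≤ x := by
      have : x' ∈ {y | κ (Iic y) ≤ ENNReal.ofReal ((2:ℝ) ^ (k + 1))} := by
        simp only [mem_ofPred_eq, hx']
        exact ENNReal.ofReal_le_ofReal (by rw [hk1]; linarith)
      rwa [hxs] at this
    have hκEk : κ (E k) = ENNReal.ofReal (2 ^ k) := by
      rw [hEk, measure_sdiff (Iic_subset_Iic.2 hxx) measurableSet_Iic.nullMeasurableSet (hκfin _),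
        hx, hx', ← ENNReal.ofReal_sub _ h2k.le, hk1]
      congr 1
      ring
    have hEx : E k ⊆ Iic x := by rw [hEk]; exact sdiff_subset
    have hl : 0 < c / 8 * (4 * 2 ^ k) := by positivity
    have hle := hkey _ hl x hxpos (E k) hEx
    rw [← hκE _ (hEm k), hκEk, mul_assoc, ← ENNReal.ofReal_mul (by positivity),
      show c / (c / 8 * (4 * 2 ^ k)) * 2 ^ k = 2 by field_simp; norm_num] at hle
    have hβle : β (c / 8 * (4 * 2 ^ k)) x ≤ ∫⁻ y in E k, extE Φ (h y) ∂ν := by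
      refine (ENNReal.add_le_add_iff_right (hβtop _ hl x hxpos)).1 (le_trans (le_of_eq ?_) hle)
      simp [mul_two]
    refine le_trans ?_ hβle
    rw [hβ]
    calc _ ≤ ∫⁻ y in E (k + 1), extE Φ (ENNReal.ofReal (c / 8 * (4 * 2 ^ k)) /
          ENNReal.ofReal y) ∂ν := by
          refine setLIntegral_mono' (hEm _) fun y hy => hΦ.extE_monotone ?_
          rw [ENNReal.ofReal_mul (by positivity)]
          gcongr
          rw [← hk2]
          exact hy.2
      _ ≤ _ := by
          refine lintegral_mono_set fun y hy => ?_
          by_contra hyx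
          have : y ∈ {y | κ (Iic y) ≤ ENNReal.ofReal ((2:ℝ) ^ (k + 1))} := by
            rw [hxs, mem_Iic]; exact not_lt.1 fun h => hyx (mem_Ioi.2 h)
          exact absurd (hy.1.trans_le this) (lt_irrefl _)
  have hcover : ∀ y, y ∉ ⋃ k, E (k + 1) → κ (Iic y) = 0 := by
    intro y hy
    by_contra hne
    obtain ⟨n, hn⟩ := exists_mem_Ioc_zpow (ENNReal.toReal_pos hne (hκfin y)) one_lt_two
    refine hy (mem_iUnion.2 ⟨n - 1, ?_⟩)
    simp only [hE, sub_add_cancel, mem_ofPred_eq]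
    exact ⟨(ENNReal.ofReal_lt_iff_lt_toReal (by positivity) (hκfin y)).2 hn.1,
      (ENNReal.le_ofReal_iff_toReal_le (hκfin y) (by positivity)).2 hn.2⟩
  have hEm1 : ∀ k : ℤ, MeasurableSet (E (k + 1)) := fun k => hEm _
  calc _ = ∫⁻ y, extE Φ (ENNReal.ofReal (c / 8) * κ (Iic y) / ENNReal.ofReal y) ∂ν := by
        simp only [hκE _ measurableSet_Iic]
    _ = ∫⁻ y in ⋃ k, E (k + 1),
          extE Φ (ENNReal.ofReal (c / 8) * κ (Iic y) / ENNReal.ofReal y) ∂ν := by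
        rw [← lintegral_indicator (MeasurableSet.iUnion hEm1)]
        refine lintegral_congr fun y => ?_
        by_cases hy : y ∈ ⋃ k, E (k + 1)
        · rw [indicator_of_mem hy]
        · rw [indicator_of_notMem hy, hcover y hy, mul_zero, ENNReal.zero_div, hΦ.extE_zero]
    _ ≤ ∑' k, ∫⁻ y in E (k + 1),
          extE Φ (ENNReal.ofReal (c / 8) * κ (Iic y) / ENNReal.ofReal y) ∂ν :=
        lintegral_iUnion_le _ _
    _ ≤ ∑' k, ∫⁻ y in E k, extE Φ (h y) ∂ν := ENNReal.tsum_le_tsum hstep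
    _ = ∫⁻ y in ⋃ k, E k, extE Φ (h y) ∂ν := (lintegral_iUnion hEm hEd _).symm
    _ ≤ _ := setLIntegral_le_lintegral _ _

end Hardy

section Averages

variable {ν : Measure ℝ} {Φ φ ψ : ℝ → ℝ} {g : ℝ → ℝ≥0∞} {τ : ℝ → ℝ}

lemma Antitone.le_comp_add_setLIntegral [NullSingletonClass ν] (hg : Antitone g)
    (hpos : ∀ y > 0, ν (Iic y) ≠ 0) (hfin : ∀ y, ν (Iic y) ≠ ⊤)
    (hτ : ∀ y x, τ y ≤ x ↔ 0 ≤ x ∧ ν (Iic y) ≤ 2 * ν (Iic x)) {s y : ℝ} (hs : 0 < s)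
    (hsy : s ≤ y) :
    g s ≤ g (τ y) + 2 * ∫⁻ z in Ioc s y, g (τ z) * (ν (Iic z))⁻¹ ∂ν := by
  rcases le_total (ν (Iic y)) (2 * ν (Iic s)) with h | h
  · exact le_add_right (hg ((hτ y s).2 ⟨hs.le, h⟩))
  · have h2 : ν (Iic s) ≤ 2 * ν (Iic s) := le_mul_of_one_le_left' one_le_two
    obtain ⟨z₀, hz₀, hz₀'⟩ := intermediate_value_Icc hsy
      (continuous_measure_Iic hfin).continuousOn ⟨h2, h⟩
    simp only at hz₀'
    have hν : ν (Ioc s z₀) = ν (Iic s) := by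
      rw [← Iic_sdiff_Iic, measure_sdiff (Iic_subset_Iic.2 hz₀.1)
        measurableSet_Iic.nullMeasurableSet (hfin s), hz₀', two_mul,
        ENNReal.add_sub_cancel_right (hfin s)]
    refine le_add_left ?_
    calc g s = 2 * (g s * (2 * ν (Iic s))⁻¹ * ν (Iic s)) := by
          rw [ENNReal.mul_inv (Or.inl (by simp)) (Or.inl (by simp)), mul_assoc, mul_assoc,
            ENNReal.inv_mul_cancel (hpos s hs) (hfin s), mul_one, mul_comm (g s), ← mul_assoc,
            ENNReal.mul_inv_cancel (by simp) (by simp), one_mul]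
      _ = 2 * ∫⁻ _ in Ioc s z₀, g s * (2 * ν (Iic s))⁻¹ ∂ν := by
          rw [setLIntegral_const, hν]
      _ ≤ 2 * ∫⁻ z in Ioc s z₀, g (τ z) * (ν (Iic z))⁻¹ ∂ν := by
          gcongr 2 * ?_
          refine setLIntegral_mono' measurableSet_Ioc fun z hz => ?_
          have hz2 : ν (Iic z) ≤ 2 * ν (Iic s) := hz₀' ▸ monotone_measure_Iic hz.2
          have : g s ≤ g (τ z) := hg ((hτ z s).2 ⟨hs.le, hz2⟩)
          gcongr
      _ ≤ _ := by
          gcongr 2 * ?_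
          exact lintegral_mono_set (Ioc_subset_Ioc_right hz₀.2)

lemma lintegral_setLIntegral_Ioc_le [SFinite ν] {k : ℝ → ℝ≥0∞} (hk : Measurable k) (y : ℝ) :
    ∫⁻ s in Ioo 0 y, ∫⁻ z in Ioc s y, k z ∂ν ≤ ∫⁻ z in Iic y, k z * ENNReal.ofReal z ∂ν := by
  have hm : Measurable (Function.uncurry fun s z : ℝ => (Ioi s).indicator k z) := by
    have : (Function.uncurry fun s z : ℝ => (Ioi s).indicator k z) =
        {p : ℝ × ℝ | p.1 < p.2}.indicator fun p => k p.2 := by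
      ext p
      simp [Function.uncurry, indicator]
    rw [this]
    exact (hk.comp measurable_snd).indicator (measurableSet_lt measurable_fst measurable_snd)
  calc ∫⁻ s in Ioo 0 y, ∫⁻ z in Ioc s y, k z ∂ν
      = ∫⁻ s in Ioo 0 y, ∫⁻ z in Iic y, (Ioi s).indicator k z ∂ν := by
        refine lintegral_congr fun s => ?_
        rw [lintegral_indicator measurableSet_Ioi, Measure.restrict_restrict measurableSet_Ioi,
          Ioi_inter_Iic]
    _ = ∫⁻ z in Iic y, (∫⁻ s in Ioo 0 y, (Ioi s).indicator k z) ∂ν :=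
        lintegral_lintegral_swap hm.aemeasurable
    _ ≤ _ := by
        refine lintegral_mono fun z => ?_
        calc ∫⁻ s in Ioo 0 y, (Ioi s).indicator k z
            = ∫⁻ s in Ioo 0 y, (Iio z).indicator (fun _ => k z) s := by
              simp [indicator]
          _ ≤ ∫⁻ s in Ioi 0, (Iio z).indicator (fun _ => k z) s :=
              lintegral_mono_set Ioo_subset_Ioi_self
          _ = k z * ENNReal.ofReal z := by
              rw [lintegral_indicator measurableSet_Iio, setLIntegral_const,
                Measure.restrict_apply measurableSet_Iio, Iio_inter_Ioi, Real.volume_Ioo, sub_zero]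

lemma Antitone.average_le [SFinite ν] [NullSingletonClass ν] (hg : Antitone g)
    (hpos : ∀ y > 0, ν (Iic y) ≠ 0) (hfin : ∀ y, ν (Iic y) ≠ ⊤) (hτm : Measurable τ)
    (hτ : ∀ y x, τ y ≤ x ↔ 0 ≤ x ∧ ν (Iic y) ≤ 2 * ν (Iic x)) {y : ℝ} (hy : 0 < y) :
    (∫⁻ s in Ioo 0 y, g s) / ENNReal.ofReal y ≤ g (τ y) +
      2 * ((∫⁻ z in Iic y, g (τ z) * ENNReal.ofReal (z / (ν (Iic z)).toReal) ∂ν) /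
        ENNReal.ofReal y) := by
  have hy0 : ENNReal.ofReal y ≠ 0 := by simpa using hy
  have hk : Measurable fun z => g (τ z) * (ν (Iic z))⁻¹ :=
    (hg.measurable.comp hτm).mul (continuous_measure_Iic hfin).measurable.inv
  refine ENNReal.div_le_of_le_mul ?_
  calc ∫⁻ s in Ioo 0 y, g s
      ≤ ∫⁻ s in Ioo 0 y,
          (g (τ y) + 2 * ∫⁻ z in Ioc s y, g (τ z) * (ν (Iic z))⁻¹ ∂ν) :=
        setLIntegral_mono' measurableSet_Ioo fun s hs =>
          hg.le_comp_add_setLIntegral hpos hfin hτ hs.1 hs.2.le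
    _ = g (τ y) * ENNReal.ofReal y +
          2 * ∫⁻ s in Ioo 0 y, ∫⁻ z in Ioc s y, g (τ z) * (ν (Iic z))⁻¹ ∂ν := by
        rw [lintegral_add_left measurable_const, setLIntegral_const, Real.volume_Ioo, sub_zero,
          lintegral_const_mul' _ _ (by simp)]
    _ ≤ g (τ y) * ENNReal.ofReal y +
          2 * ∫⁻ z in Iic y, g (τ z) * ENNReal.ofReal (z / (ν (Iic z)).toReal) ∂ν := by
        gcongr _ + 2 * ?_
        refine (lintegral_setLIntegral_Ioc_le hk y).trans (lintegral_mono fun z => ?_)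
        rcases le_or_gt z 0 with hz | hz
        · simp [ENNReal.ofReal_of_nonpos hz]
        · simp only
          rw [ENNReal.ofReal_div_of_pos (ENNReal.toReal_pos (hpos z hz) (hfin z)),
            ENNReal.ofReal_toReal (hfin z), mul_assoc, div_eq_mul_inv, mul_comm (ENNReal.ofReal z)]
    _ = _ := by
        rw [add_mul, mul_assoc, ENNReal.div_mul_cancel hy0 ENNReal.ofReal_ne_top]

theorem modular_average_le [SFinite ν] [NullSingletonClass ν] (hΦ : IsNFunction Φ φ)
    (hψ : InvOn ψ φ (Ioi 0) (Ioi 0)) (h0 : ν (Iic 0) = 0) (hpos : ∀ y > 0, ν (Iic y) ≠ 0)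
    (hfin : ∀ y, ν (Iic y) ≠ ⊤) (htop : ν univ = ⊤) {c : ℝ} (hc : 0 < c) (β : ℝ → ℝ → ℝ≥0∞)
    (hβ : ∀ l x, β l x = ∫⁻ y in Ioi x, extE Φ (ENNReal.ofReal l / ENNReal.ofReal y) ∂ν)
    (hβ0 : ∀ l > 0, ∀ x > 0, β l x ≠ 0) (hβtop : ∀ l > 0, ∀ x > 0, β l x ≠ ⊤)
    (hcond : ∀ l > 0, ∀ x > 0,
      ∫⁻ y in Iic x, ENNReal.ofReal (y / (ν (Iic y)).toReal) *
        extE ψ (β l x * ENNReal.ofReal (c / l) * ENNReal.ofReal (y / (ν (Iic y)).toReal)) ∂ν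
        ≤ ENNReal.ofReal (l / c)) (hg : Antitone g) :
    ∫⁻ y, extE Φ ((∫⁻ s in Ioo 0 y, g s) / ENNReal.ofReal y) ∂ν ≤
      ∫⁻ y, extE Φ (4 * ENNReal.ofReal (max 2 (32 / c)) * g y) ∂ν := by
  obtain ⟨τ, hτm, hτ, hmap⟩ := exists_map_eq_two_smul h0 hfin htop
  set D := ENNReal.ofReal (max 2 (32 / c)) with hD
  have hD2 : 2 ≤ D := by
    rw [hD, show (2:ℝ≥0∞) = ENNReal.ofReal 2 by simp]
    exact ENNReal.ofReal_le_ofReal (le_max_left _ _)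
  have hDc : ENNReal.ofReal (32 / c) ≤ D := ENNReal.ofReal_le_ofReal (le_max_right _ _)
  have hgτ : Measurable fun y => g (τ y) := hg.measurable.comp hτm
  have hhardy := modular_hardy_le hΦ hψ h0 (fun _ => ENNReal.ofReal_ne_top)
    (hgτ.const_mul (ENNReal.ofReal (32 / c))) hc β hβ hβ0 hβtop hcond
  have hae : ∀ᵐ y ∂ν, 0 < y := by
    rw [ae_iff]
    convert h0 using 2
    ext y
    simp
  have hmD : Measurable fun y => extE Φ (D * g y) :=
    hΦ.extE_monotone.measurable.comp (hg.measurable.const_mul D)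
  have hm2 : Measurable fun y => extE Φ (2 * g (τ y)) :=
    hΦ.extE_monotone.measurable.comp (hgτ.const_mul 2)
  calc ∫⁻ y, extE Φ ((∫⁻ s in Ioo 0 y, g s) / ENNReal.ofReal y) ∂ν
      ≤ ∫⁻ y, (extE Φ (2 * g (τ y)) + extE Φ (ENNReal.ofReal (c / 8) *
          (∫⁻ z in Iic y, ENNReal.ofReal (32 / c) * g (τ z) *
            ENNReal.ofReal (z / (ν (Iic z)).toReal) ∂ν) / ENNReal.ofReal y)) ∂ν := by
        refine lintegral_mono_ae ?_
        filter_upwards [hae] with y hy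
        refine (hΦ.extE_monotone (hg.average_le hpos hfin hτm hτ hy)).trans
          ((hΦ.extE_add_le _ _).trans (le_of_eq ?_))
        congr 2
        simp only [mul_assoc]
        rw [lintegral_const_mul' _ _ ENNReal.ofReal_ne_top, ← mul_assoc (ENNReal.ofReal (c / 8)),
          ← ENNReal.ofReal_mul (by positivity), show c / 8 * (32 / c) = 2 * 2 by field_simp; norm_num,
          ENNReal.ofReal_mul zero_le_two, ENNReal.ofReal_ofNat, mul_div_assoc, mul_assoc]
    _ ≤ (∫⁻ y, extE Φ (2 * g (τ y)) ∂ν) +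
          ∫⁻ y, extE Φ (ENNReal.ofReal (32 / c) * g (τ y)) ∂ν := by
        rw [lintegral_add_left hm2]
        gcongr
    _ ≤ (∫⁻ y, extE Φ (D * g (τ y)) ∂ν) + ∫⁻ y, extE Φ (D * g (τ y)) ∂ν :=
        add_le_add (lintegral_mono fun y => hΦ.extE_monotone (mul_le_mul_left hD2 _))
          (lintegral_mono fun y => hΦ.extE_monotone (mul_le_mul_left hDc _))
    _ = 2 * (2 * ∫⁻ y, extE Φ (D * g y) ∂ν) := by
        rw [← two_mul, ← lintegral_map hmD hτm, hmap, lintegral_smul_measure, smul_eq_mul]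
    _ = ∫⁻ y, 2 * (2 * extE Φ (D * g y)) ∂ν := by
        rw [lintegral_const_mul' _ _ (by simp), lintegral_const_mul' _ _ (by simp)]
    _ ≤ _ := by
        refine lintegral_mono fun y => ?_
        calc 2 * (2 * extE Φ (D * g y)) ≤ 2 * extE Φ (2 * (D * g y)) := by
              gcongr
              exact hΦ.two_mul_extE_le _
          _ ≤ extE Φ (2 * (2 * (D * g y))) := hΦ.two_mul_extE_le _
          _ = _ := by
              congr 1
              rw [← mul_assoc, ← mul_assoc]
              norm_num

end Averages

section Weights

variable {ν : Measure ℝ} {Φ φ ψ u : ℝ → ℝ} {g : ℝ → ℝ≥0∞}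

lemma setLIntegral_extE_div_ne_zero (hΦ : IsNFunction Φ φ) (hfin : ∀ y, ν (Iic y) ≠ ⊤)
    (htop : ν univ = ⊤) {l x : ℝ} (hl : 0 < l) (hx : 0 < x) :
    ∫⁻ y in Ioi x, extE Φ (ENNReal.ofReal l / ENNReal.ofReal y) ∂ν ≠ 0 := by
  have hm : Measurable fun y : ℝ => extE Φ (ENNReal.ofReal l / ENNReal.ofReal y) :=
    hΦ.extE_monotone.measurable.comp (measurable_const.div ENNReal.measurable_ofReal)
  intro h
  rw [lintegral_eq_zero_iff hm, Filter.EventuallyEq, ae_restrict_iff' measurableSet_Ioi] at h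
  have hIoi : ν (Ioi x) = 0 := by
    refine measure_mono_null (fun y hy => ?_) h
    intro hcon
    have hy0 : 0 < y := hx.trans hy
    have := hcon hy
    rw [← ENNReal.ofReal_div_of_pos hy0] at this
    simp only [extE, ENNReal.ofReal_ne_top, if_false, Pi.zero_apply, ENNReal.ofReal_eq_zero] at this
    rw [ENNReal.toReal_ofReal (by positivity)] at this
    exact absurd (hΦ.pos (div_pos hl hy0)) (not_lt.2 this)
  have : ν univ ≤ ν (Iic x) + ν (Ioi x) := by
    rw [← Iic_union_Ioi (a := x)]
    exact measure_union_le _ _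
  rw [htop, hIoi, add_zero] at this
  exact hfin x (top_le_iff.1 this)

lemma measure_Iic_ne_zero_of_setLIntegral_ne_top [NullSingletonClass ν] (hΦ : IsNFunction Φ φ)
    (hψ : InvOn ψ φ (Ioi 0) (Ioi 0)) (h0 : ν (Iic 0) = 0) (hfin : ∀ y, ν (Iic y) ≠ ⊤)
    (htop : ν univ = ⊤)
    (hcond : ∀ x > 0, ∃ B ≠ 0, ∫⁻ y in Iic x, ENNReal.ofReal (y / (ν (Iic y)).toReal) *
      extE ψ (B * ENNReal.ofReal (y / (ν (Iic y)).toReal)) ∂ν ≠ ⊤) :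
    ∀ y > 0, ν (Iic y) ≠ 0 := by
  intro a₀ ha₀ hνa₀
  obtain ⟨b, hb⟩ := ((tendsto_order.1 (htop ▸ tendsto_measure_Iic_atTop ν)).1 0 (by simp)).exists
  obtain ⟨a, -, hνa, ha⟩ := exists_setOf_measure_Iic_le_eq h0 hfin ⟨b, hb⟩
  have hapos : 0 < a := by
    have : a₀ ∈ {y | ν (Iic y) ≤ 0} := hνa₀.le
    rw [ha] at this
    exact ha₀.trans_le this
  have hab : a < b := by
    by_contra! h
    exact absurd (hb.trans_le ((monotone_measure_Iic h).trans hνa.le)) (lt_irrefl _)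
  obtain ⟨B, hB0, hB⟩ := hcond b (hapos.trans hab)
  set I := ∫⁻ y in Iic b, ENNReal.ofReal (y / (ν (Iic y)).toReal) *
      extE ψ (B * ENNReal.ofReal (y / (ν (Iic y)).toReal)) ∂ν with hI
  set B' := (min B 1).toReal with hB'
  have hmin : min B 1 ≠ ⊤ := ne_top_of_le_ne_top ENNReal.one_ne_top (min_le_right _ _)
  have hB'pos : 0 < B' := ENNReal.toReal_pos (by simp [hB0]) hmin
  have hB'le : ENNReal.ofReal B' ≤ B := by
    rw [hB', ENNReal.ofReal_toReal hmin]
    exact min_le_left _ _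
  set M := (I.toReal + 1) / a with hM
  have hMpos : 0 < M := by positivity
  have hφM : 0 < φ M := hΦ.2.1 hMpos
  have hUb := ENNReal.toReal_pos hb.ne' (hfin b)
  set v := min ((ν (Iic b)).toReal / 2) (B' * a / φ M) with hv
  have hvpos : 0 < v := lt_min (by positivity) (by positivity)
  have hvb : ENNReal.ofReal v < ν (Iic b) := by
    rw [ENNReal.ofReal_lt_iff_lt_toReal hvpos.le (hfin b)]
    exact (min_le_left _ _).trans_lt (half_lt_self hUb)
  obtain ⟨x, -, hνx, hx⟩ := exists_setOf_measure_Iic_le_eq h0 hfin ⟨b, hvb⟩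
  have hxb : x ≤ b := by
    by_contra! h
    exact absurd (hvb.trans_le ((monotone_measure_Iic h.le).trans hνx.le)) (lt_irrefl _)
  have hax : a ≤ x := by
    have : a ∈ {y | ν (Iic y) ≤ ENNReal.ofReal v} := by simp [hνa]
    rwa [hx] at this
  have hνIoc : ν (Ioc a x) = ENNReal.ofReal v := by
    rw [← Iic_sdiff_Iic, measure_sdiff (Iic_subset_Iic.2 hax)
        measurableSet_Iic.nullMeasurableSet (hfin a), hνx, hνa, tsub_zero]
  have hlow : ENNReal.ofReal (I.toReal + 1) ≤ I := by
    calc ENNReal.ofReal (I.toReal + 1)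
        = ENNReal.ofReal (a / v) * ENNReal.ofReal M * ν (Ioc a x) := by
          rw [hνIoc, ← ENNReal.ofReal_mul (by positivity), ← ENNReal.ofReal_mul (by positivity)]
          congr 1
          rw [hM]
          field_simp
      _ = ∫⁻ _ in Ioc a x, ENNReal.ofReal (a / v) * ENNReal.ofReal M ∂ν :=
          (setLIntegral_const _ _).symm
      _ ≤ ∫⁻ y in Ioc a x, ENNReal.ofReal (y / (ν (Iic y)).toReal) *
            extE ψ (B * ENNReal.ofReal (y / (ν (Iic y)).toReal)) ∂ν := by
          refine setLIntegral_mono' measurableSet_Ioc fun y hy => ?_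
          have hy0 : ν (Iic y) ≠ 0 := fun h => by
            have : y ∈ {y | ν (Iic y) ≤ 0} := h.le
            rw [ha] at this
            exact absurd hy.1 (not_lt.2 this)
          have hUpos := ENNReal.toReal_pos hy0 (hfin y)
          have hUv : (ν (Iic y)).toReal ≤ v :=
            (ENNReal.le_ofReal_iff_toReal_le (hfin y) hvpos.le).1
              ((monotone_measure_Iic hy.2).trans hνx.le)
          have hW : ENNReal.ofReal (a / v) ≤ ENNReal.ofReal (y / (ν (Iic y)).toReal) :=
            ENNReal.ofReal_le_ofReal
              (div_le_div₀ (hapos.trans hy.1).le hy.1.le hUpos hUv)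
          refine mul_le_mul' hW ?_
          have hs : ENNReal.ofReal (φ M) ≤ B * ENNReal.ofReal (y / (ν (Iic y)).toReal) := by
            refine le_trans ?_ (mul_le_mul' hB'le hW)
            rw [← ENNReal.ofReal_mul hB'pos.le]
            refine ENNReal.ofReal_le_ofReal ?_
            have := min_le_right ((ν (Iic b)).toReal / 2) (B' * a / φ M)
            rw [← hv, le_div_iff₀ hφM] at this
            rw [← mul_div_assoc, le_div_iff₀ hvpos]
            linarith
          have := hΦ.ofReal_le_extE_inv hψ hφM hs
          rwa [hψ.1 hMpos] at this
      _ ≤ I := lintegral_mono_set (Ioc_subset_Iic_self.trans (Iic_subset_Iic.2 hxb))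
  rw [ENNReal.ofReal_le_iff_le_toReal hB] at hlow
  linarith

/-- The measure `u(x) dx` on the positive half-line. -/
def weightMeasure (u : ℝ → ℝ) : Measure ℝ :=
  (volume.restrict (Ioi 0)).withDensity fun x => ENNReal.ofReal (u x)

instance : SFinite (weightMeasure u) := by
  unfold weightMeasure
  infer_instance

instance : NullSingletonClass (weightMeasure u) :=
  ⟨fun x => withDensity_absolutelyContinuous _ _ (measure_singleton x)⟩

lemma setLIntegral_weightMeasure (hu : Measurable u) (f : ℝ → ℝ≥0∞) {s : Set ℝ}
    (hs : MeasurableSet s) :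
    ∫⁻ x in s, f x ∂weightMeasure u = ∫⁻ x in s ∩ Ioi 0, f x * ENNReal.ofReal (u x) := by
  rw [weightMeasure, setLIntegral_withDensity_eq_setLIntegral_mul_non_measurable _
    hu.ennreal_ofReal _ hs (by simp), Measure.restrict_restrict hs]
  simp only [Pi.mul_apply, mul_comm]

lemma lintegral_weightMeasure (hu : Measurable u) (f : ℝ → ℝ≥0∞) :
    ∫⁻ x, f x ∂weightMeasure u = ∫⁻ x in Ioi 0, f x * ENNReal.ofReal (u x) := by
  simpa using setLIntegral_weightMeasure hu f MeasurableSet.univ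

lemma weightMeasure_apply {s : Set ℝ} (hs : MeasurableSet s) :
    weightMeasure u s = ∫⁻ x in s ∩ Ioi 0, ENNReal.ofReal (u x) := by
  rw [weightMeasure, withDensity_apply _ hs, Measure.restrict_restrict hs]

lemma weightMeasure_Iic_zero : weightMeasure u (Iic 0) = 0 := by
  rw [weightMeasure_apply measurableSet_Iic, Iic_inter_Ioi]
  simp

lemma Uw_eq (hu : IsWeight u) {y : ℝ} (hy : 0 ≤ y) :
    Uw u y = (weightMeasure u (Iic y)).toReal := by
  rw [Uw, intervalIntegral.integral_of_le hy,
    integral_eq_lintegral_of_nonneg_ae (Filter.Eventually.of_forall hu.2.1)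
      hu.1.aestronglyMeasurable, weightMeasure_apply measurableSet_Iic, inter_comm, Ioi_inter_Iic]

lemma weightMeasure_Ioc_ne_top (hu : IsWeight u) {a b : ℝ} (ha : 0 < a) :
    weightMeasure u (Ioc a b) ≠ ⊤ := by
  have hint : IntegrableOn u (Icc a b) :=
    hu.2.2.integrableOn_compact_subset (fun x hx => ha.trans_le hx.1) isCompact_Icc
  rw [weightMeasure_apply measurableSet_Ioc]
  refine ne_top_of_le_ne_top hint.lintegral_lt_top.ne (lintegral_mono_set ?_)
  exact inter_subset_left.trans Ioc_subset_Icc_self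

lemma hardyBeta_eq (hu : Measurable u) {l x : ℝ} (hx : 0 < x) (hl : 0 < l) :
    hardyBeta Φ u l x =
      ∫⁻ y in Ioi x, extE Φ (ENNReal.ofReal l / ENNReal.ofReal y) ∂weightMeasure u := by
  rw [setLIntegral_weightMeasure hu _ measurableSet_Ioi,
    inter_eq_left.2 (Ioi_subset_Ioi hx.le), hardyBeta]
  refine setLIntegral_congr_fun measurableSet_Ioi fun y hy => ?_
  have hy0 : 0 < y := hx.trans hy
  rw [← ENNReal.ofReal_div_of_pos hy0, extE, if_neg ENNReal.ofReal_ne_top,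
    ENNReal.toReal_ofReal (by positivity)]

lemma HardyConditions.exists_setLIntegral_le (hu : IsWeight u) (h : HardyConditions Φ φ ψ u) :
    ∃ c > 0, ∀ l > 0, ∀ x > 0,
      ∫⁻ y in Iic x, ENNReal.ofReal (y / (weightMeasure u (Iic y)).toReal) *
        extE ψ ((∫⁻ y in Ioi x, extE Φ (ENNReal.ofReal l / ENNReal.ofReal y) ∂weightMeasure u) *
          ENNReal.ofReal (c / l) * ENNReal.ofReal (y / (weightMeasure u (Iic y)).toReal))
          ∂weightMeasure u ≤ ENNReal.ofReal (l / c) := by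
  obtain ⟨c, hc, -, h⟩ := h
  refine ⟨c, hc, fun l hl x hx => le_trans (le_of_eq ?_) (h l hl x hx)⟩
  rw [← hardyBeta_eq hu.1 hx hl, setLIntegral_weightMeasure hu.1 _ measurableSet_Iic, inter_comm,
    Ioi_inter_Iic, setLIntegral_congr Ioo_ae_eq_Ioc.symm]
  refine setLIntegral_congr_fun measurableSet_Ioo fun y hy => ?_
  rw [← Uw_eq hu hy.1.le, mul_div_right_comm y, ENNReal.ofReal_mul' (hu.2.1 y),
    ENNReal.ofReal_div_of_pos hl, mul_comm (ENNReal.ofReal c) (hardyBeta Φ u l x), mul_div_assoc]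
  ring

lemma HardyConditions.exists_modular_average_le (hΦ : IsNFunction Φ φ)
    (hψ : InvOn ψ φ (Ioi 0) (Ioi 0)) (hu : IsWeight u)
    (hutop : ∫⁻ x in Ioi (0:ℝ), ENNReal.ofReal (u x) = ⊤) (h : HardyConditions Φ φ ψ u) :
    ∃ C > 0, ∀ g : ℝ → ℝ≥0∞, Antitone g →
      ∫⁻ y, extE Φ ((∫⁻ s in Ioo 0 y, g s) / ENNReal.ofReal y) ∂weightMeasure u ≤
        ∫⁻ y, extE Φ (ENNReal.ofReal C * g y) ∂weightMeasure u := by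
  obtain ⟨c, hc, hcond⟩ := h.exists_setLIntegral_le hu
  have htop : weightMeasure u univ = ⊤ := by
    rw [weightMeasure_apply MeasurableSet.univ, univ_inter, hutop]
  have h0 := weightMeasure_Iic_zero (u := u)
  by_cases hfin : ∀ y, weightMeasure u (Iic y) ≠ ⊤
  · have hβ0 : ∀ l > 0, ∀ x > 0, ∫⁻ y in Ioi x,
        extE Φ (ENNReal.ofReal l / ENNReal.ofReal y) ∂weightMeasure u ≠ 0 := fun l hl x hx =>
      setLIntegral_extE_div_ne_zero hΦ hfin htop hl hx
    have hpos := measure_Iic_ne_zero_of_setLIntegral_ne_top hΦ hψ h0 hfin htop fun x hx =>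
      ⟨_, mul_ne_zero (hβ0 1 one_pos x hx) (by simpa using hc),
        ne_top_of_le_ne_top ENNReal.ofReal_ne_top (hcond 1 one_pos x hx)⟩
    refine ⟨4 * max 2 (32 / c), by positivity, fun g hg => ?_⟩
    rw [ENNReal.ofReal_mul (by norm_num), ENNReal.ofReal_ofNat]
    refine modular_average_le hΦ hψ h0 hpos hfin htop hc _ (fun _ _ => rfl) hβ0 ?_ hcond hg
    intro l hl x hx hβ
    refine ENNReal.ofReal_ne_top (top_le_iff.1 (le_trans (le_of_eq ?_) (hcond l hl x hx)))
    rw [hβ, ENNReal.top_mul (by simpa using div_pos hc hl)]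
    have : ∀ᵐ y ∂(weightMeasure u).restrict (Iic x), (⊤:ℝ≥0∞) =
        ENNReal.ofReal (y / (weightMeasure u (Iic y)).toReal) *
          extE ψ (⊤ * ENNReal.ofReal (y / (weightMeasure u (Iic y)).toReal)) := by
      refine ae_restrict_of_ae ?_
      rw [ae_iff]
      refine measure_mono_null (fun y hy => ?_) h0
      by_contra hy0
      have hy0' : 0 < y := lt_of_not_ge fun h => hy0 h
      have hW : ENNReal.ofReal (y / (weightMeasure u (Iic y)).toReal) ≠ 0 := by
        simpa using div_pos hy0' (ENNReal.toReal_pos (hpos y hy0') (hfin y))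
      exact hy (by simp [ENNReal.top_mul hW, extE, ENNReal.mul_top hW])
    rw [← lintegral_congr_ae this, setLIntegral_const, ENNReal.top_mul (hpos x hx)]
  · push Not at hfin
    obtain ⟨b, hb⟩ := hfin
    have hall : ∀ s > 0, weightMeasure u (Iic s) = ⊤ := by
      intro s hs
      by_contra hs'
      have : weightMeasure u (Iic b) ≤ weightMeasure u (Iic s) + weightMeasure u (Ioc s b) :=
        (measure_mono fun x hx => (le_or_gt x s).imp id fun h => ⟨h, hx⟩).trans
          (measure_union_le _ _)
      rw [hb, top_le_iff, ENNReal.add_eq_top] at this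
      exact this.elim hs' (weightMeasure_Ioc_ne_top hu hs)
    refine ⟨1, one_pos, fun g hg => ?_⟩
    simp only [ENNReal.ofReal_one, one_mul]
    by_cases hg0 : ∀ s > 0, g s = 0
    · refine le_trans (le_of_eq ?_) zero_le
      refine (lintegral_congr fun y => ?_).trans lintegral_zero
      rw [setLIntegral_congr_fun measurableSet_Ioo (fun s hs => hg0 s hs.1)]
      simp [hΦ.extE_zero]
    · push Not at hg0
      obtain ⟨s, hs, hgs⟩ := hg0
      have hΦs : extE Φ (g s) ≠ 0 := by
        unfold extE
        split_ifs with ht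
        · simp
        · simpa using hΦ.pos (ENNReal.toReal_pos hgs ht)
      refine le_top.trans ?_
      calc ⊤ = ∫⁻ _ in Iic s, extE Φ (g s) ∂weightMeasure u := by
            rw [setLIntegral_const, hall s hs, ENNReal.mul_top hΦs]
        _ ≤ ∫⁻ y in Iic s, extE Φ (g y) ∂weightMeasure u :=
            setLIntegral_mono' measurableSet_Iic fun y hy => hΦ.extE_monotone (hg hy)
        _ ≤ _ := setLIntegral_le_lintegral _ _

lemma rearr_antitone (f : ℝ → ℝ≥0∞) : Antitone (rearr f) := fun _ _ h =>
  sInf_le_sInf fun _ hl => le_trans hl (ENNReal.ofReal_le_ofReal h)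

end Weights

theorem statement3
    (Φ φ ψ : ℝ → ℝ) (hΦ : IsNFunction Φ φ) (hD : Doubling Φ)
    (hψ : InvOn ψ φ (Ioi 0) (Ioi 0))
    (u : ℝ → ℝ) (hu : IsWeight u)
    (hutop : (∫⁻ x in Ioi (0:ℝ), ENNReal.ofReal (u x)) = ⊤)
    (hHardy : HardyConditions Φ φ ψ u) :
    ∃ C > 0, ∀ f : ℝ → ℝ≥0∞, Measurable f →
      ogauge Φ u (fun t => (∫⁻ s in Ioo (0:ℝ) t, rearr f s) / ENNReal.ofReal t) ≤
        ENNReal.ofReal C * ogauge Φ u (rearr f) := by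
  obtain ⟨C, hC, hmod⟩ := hHardy.exists_modular_average_le hΦ hψ hu hutop
  refine ⟨C, hC, fun f _ => ?_⟩
  have hC0 : ENNReal.ofReal C ≠ 0 := by simpa using hC
  unfold ogauge
  rw [sInf_eq_iInf' (s := {l : ℝ≥0∞ | 0 < l ∧
      (∫⁻ x in Ioi (0:ℝ), extE Φ (rearr f x / l) * ENNReal.ofReal (u x)) ≤ 1}),
    ENNReal.mul_iInf_of_ne hC0 ENNReal.ofReal_ne_top]
  refine le_iInf fun ⟨l, hl, hfl⟩ => ?_
  rcases eq_or_ne l ⊤ with rfl | hltop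
  · simp [ENNReal.mul_top hC0]
  refine sInf_le ⟨ENNReal.mul_pos hC0 hl.ne', le_trans ?_ hfl⟩
  set r := (ENNReal.ofReal C * l)⁻¹ with hr
  have hrtop : r ≠ ⊤ := ENNReal.inv_ne_top.2 (mul_ne_zero hC0 hl.ne')
  have hanti : Antitone fun y => r * rearr f y := fun a b h => by
    have := rearr_antitone f h
    simp only
    gcongr
  have := hmod _ hanti
  rw [lintegral_weightMeasure hu.1, lintegral_weightMeasure hu.1] at this
  have haverage : ∀ x, (∫⁻ s in Ioo 0 x, rearr f s) / ENNReal.ofReal x / (ENNReal.ofReal C * l) =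
      (∫⁻ s in Ioo 0 x, r * rearr f s) / ENNReal.ofReal x := fun x => by
    rw [lintegral_const_mul' _ _ hrtop, div_eq_mul_inv, div_eq_mul_inv, div_eq_mul_inv]
    ring
  have hdiv : ∀ x, ENNReal.ofReal C * (r * rearr f x) = rearr f x / l := fun x => by
    rw [hr, ENNReal.mul_inv (Or.inl hC0) (Or.inl ENNReal.ofReal_ne_top), ← mul_assoc, ← mul_assoc,
      ENNReal.mul_inv_cancel hC0 ENNReal.ofReal_ne_top, one_mul, div_eq_mul_inv, mul_comm]
  simp only [hdiv] at this
  simpa only [haverage] using this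

end
end

section
/- Fix 1 < p ≤ q < ∞ and p' = p/(p-1). Let k: ℝ_+ → [0,∞) be nonincreasing with k(t/2) ≤ C k(t) for all t ∈ ℝ_+ and ∫_0^a k(√(x²+y²)) dy < ∞ for all a, x ∈ ℝ_+, and set K(x,y) = k(√(x²+y²)). Then there is c > 0 with [ ∫_{ℝ_+} (T_K f)(x)^q dx ]^{1/q} ≤ c [ ∫_{ℝ_+} f(y)^p dy ]^{1/p} for all f ∈ M_+(ℝ_+), if and only if both sup_{x>0} x ( ∫_x^∞ k(y)^q dy )^{p'/q} < ∞ and sup_{x>0} x ( ∫_x^∞ k(y)^{p'} dy )^{q/p'} < ∞. -/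
open MeasureTheory Set
open scoped ENNReal

noncomputable section

lemma ENNReal.rpow_neg_le_rpow_neg {a b : ℝ≥0∞} (h : a ≤ b) {z : ℝ} (hz : 0 ≤ z) :
    b ^ (-z) ≤ a ^ (-z) := by
  rw [ENNReal.rpow_neg, ENNReal.rpow_neg]
  exact ENNReal.inv_le_inv.2 (ENNReal.rpow_le_rpow h hz)

lemma lintegral_Ioi_ofReal_rpow {a : ℝ} (ha : 1 < a) {x : ℝ} (hx : 0 < x) :
    ∫⁻ y in Ioi x, ENNReal.ofReal y ^ (-a) =
      ENNReal.ofReal (1 / (a - 1)) * ENNReal.ofReal x ^ (1 - a) := by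
  have h1 : ∫⁻ y in Ioi x, ENNReal.ofReal y ^ (-a) = ∫⁻ y in Ioi x, ENNReal.ofReal (y ^ (-a)) :=
    setLIntegral_congr_fun measurableSet_Ioi
      fun y hy => ENNReal.ofReal_rpow_of_pos (hx.trans hy)
  rw [h1, ← ofReal_integral_eq_lintegral_ofReal
    (integrableOn_Ioi_rpow_of_lt (by linarith) hx)
    ((ae_restrict_iff' measurableSet_Ioi).2
      (.of_forall fun y hy => Real.rpow_nonneg (hx.trans hy).le _)),
    integral_Ioi_rpow_of_lt (by linarith) hx, ENNReal.ofReal_rpow_of_pos hx,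
    ← ENNReal.ofReal_mul (by apply one_div_nonneg.2; linarith)]
  congr 1
  have h2 : a - 1 ≠ 0 := by linarith
  have h3 : -a + 1 ≠ 0 := by linarith
  rw [show 1 - a = -a + 1 by ring]
  field_simp
  ring

lemma lintegral_Ioc_ofReal_rpow {a : ℝ} (ha : a < 1) {x : ℝ} (hx : 0 < x) :
    ∫⁻ y in Ioc 0 x, ENNReal.ofReal y ^ (-a) =
      ENNReal.ofReal (1 / (1 - a)) * ENNReal.ofReal x ^ (1 - a) := by
  have h1 : ∫⁻ y in Ioc 0 x, ENNReal.ofReal y ^ (-a) =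
      ∫⁻ y in Ioc 0 x, ENNReal.ofReal (y ^ (-a)) :=
    setLIntegral_congr_fun measurableSet_Ioc fun y hy => ENNReal.ofReal_rpow_of_pos hy.1
  rw [h1, ← ofReal_integral_eq_lintegral_ofReal
    ((intervalIntegral.intervalIntegrable_rpow' (by linarith)).1)
    ((ae_restrict_iff' measurableSet_Ioc).2
      (.of_forall fun y hy => Real.rpow_nonneg hy.1.le _)),
    ← intervalIntegral.integral_of_le hx.le, integral_rpow (.inl (by linarith)),
    ENNReal.ofReal_rpow_of_pos hx, ← ENNReal.ofReal_mul (by apply one_div_nonneg.2; linarith),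
    Real.zero_rpow (by linarith)]
  congr 1
  rw [show 1 - a = -a + 1 by ring]
  ring

lemma lintegral_max_rpow_mul_rpow {a γ : ℝ} (ha : a < 1) (hγ : 1 < γ + a) {x : ℝ} (hx : 0 < x) :
    ∫⁻ y in Ioi 0, ENNReal.ofReal (max x y) ^ (-γ) * ENNReal.ofReal y ^ (-a) =
      ENNReal.ofReal (1 / (1 - a) + 1 / (γ + a - 1)) * ENNReal.ofReal x ^ (1 - γ - a) := by
  have hX0 : ENNReal.ofReal x ≠ 0 := by simpa using hx
  have h1 : ∫⁻ y in Ioc 0 x, ENNReal.ofReal (max x y) ^ (-γ) * ENNReal.ofReal y ^ (-a) =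
      ENNReal.ofReal x ^ (-γ) * (ENNReal.ofReal (1 / (1 - a)) * ENNReal.ofReal x ^ (1 - a)) := by
    rw [← lintegral_Ioc_ofReal_rpow ha hx, ← lintegral_const_mul _ (by fun_prop)]
    exact setLIntegral_congr_fun measurableSet_Ioc fun y hy => by simp only [max_eq_left hy.2]
  have h2 : ∫⁻ y in Ioi x, ENNReal.ofReal (max x y) ^ (-γ) * ENNReal.ofReal y ^ (-a) =
      ENNReal.ofReal (1 / (γ + a - 1)) * ENNReal.ofReal x ^ (1 - (γ + a)) := by
    rw [← lintegral_Ioi_ofReal_rpow hγ hx]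
    refine setLIntegral_congr_fun measurableSet_Ioi fun y hy => ?_
    have hy' : (0:ℝ) < y := hx.trans hy
    simp only [max_eq_right (mem_Ioi.1 hy).le]
    rw [← ENNReal.rpow_add _ _ (by simpa using hy') ENNReal.ofReal_ne_top]
    congr 1
    ring
  rw [← Ioc_union_Ioi_eq_Ioi hx.le,
    lintegral_union measurableSet_Ioi (Ioc_disjoint_Ioi le_rfl), h1, h2,
    ENNReal.ofReal_add (by apply one_div_nonneg.2; linarith) (by apply one_div_nonneg.2; linarith),
    mul_left_comm, ← ENNReal.rpow_add _ _ hX0 ENNReal.ofReal_ne_top, add_mul]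
  ring_nf

section MaxKernel

variable {p q p' : ℝ}

/-- Pointwise Hölder estimate for the kernel `max(x,y)^{-(1/p'+1/q)}`. -/
lemma lintegral_max_rpow_mul_le (hpp : p.HolderConjugate p') (hq : 0 < q)
    {f : ℝ → ℝ≥0∞} (hf : Measurable f) {x : ℝ} (hx : 0 < x) :
    ∫⁻ y in Ioi 0, ENNReal.ofReal (max x y) ^ (-(p'⁻¹ + q⁻¹)) * f y ≤
      (ENNReal.ofReal (1 / (1 - p⁻¹) + 1 / (p'⁻¹ + q⁻¹ + p⁻¹ - 1)) *
        ENNReal.ofReal x ^ (-q⁻¹)) ^ p'⁻¹ *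
      (∫⁻ y in Ioi 0, ENNReal.ofReal (max x y) ^ (-(p'⁻¹ + q⁻¹)) *
        ENNReal.ofReal y ^ p'⁻¹ * f y ^ p) ^ p⁻¹ := by
  have hp0 := hpp.pos
  have hp0' := hpp.symm.pos
  have hsum := hpp.inv_add_inv_eq_one
  have hqi : 0 < q⁻¹ := inv_pos.2 hq
  have hpi' : 0 < p'⁻¹ := inv_pos.2 hp0'
  set γ := p'⁻¹ + q⁻¹ with hγ
  have key := ENNReal.lintegral_mul_le_Lp_mul_Lq (volume.restrict (Ioi (0:ℝ))) hpp.symm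
    (f := fun y => (ENNReal.ofReal (max x y) ^ (-γ)) ^ p'⁻¹ *
      ENNReal.ofReal y ^ (-(p⁻¹ * p'⁻¹)))
    (g := fun y => (ENNReal.ofReal (max x y) ^ (-γ)) ^ p⁻¹ *
      ENNReal.ofReal y ^ (p⁻¹ * p'⁻¹) * f y)
    (by fun_prop) (by fun_prop)
  have e1 : ∀ y ∈ Ioi (0:ℝ), ((fun y => (ENNReal.ofReal (max x y) ^ (-γ)) ^ p'⁻¹ *
      ENNReal.ofReal y ^ (-(p⁻¹ * p'⁻¹))) * (fun y => (ENNReal.ofReal (max x y) ^ (-γ)) ^ p⁻¹ *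
      ENNReal.ofReal y ^ (p⁻¹ * p'⁻¹) * f y)) y =
      ENNReal.ofReal (max x y) ^ (-γ) * f y := by
    intro y hy
    have hy0 : ENNReal.ofReal y ≠ 0 := by simpa using hy
    simp only [Pi.mul_apply]
    rw [show ∀ a b c d e : ℝ≥0∞, a * b * (c * d * e) = (a * c) * (b * d) * e by intros; ring,
      ← ENNReal.rpow_add_of_nonneg _ _ hpi'.le (inv_pos.2 hp0).le,
      ← ENNReal.rpow_add _ _ hy0 ENNReal.ofReal_ne_top, add_comm p'⁻¹, hsum]
    simp
  have e2 : ∀ y ∈ Ioi (0:ℝ), ((ENNReal.ofReal (max x y) ^ (-γ)) ^ p'⁻¹ *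
      ENNReal.ofReal y ^ (-(p⁻¹ * p'⁻¹))) ^ p' =
      ENNReal.ofReal (max x y) ^ (-γ) * ENNReal.ofReal y ^ (-p⁻¹) := by
    intro y hy
    rw [ENNReal.mul_rpow_of_nonneg _ _ hp0'.le, ENNReal.rpow_inv_rpow hp0'.ne',
      ← ENNReal.rpow_mul]
    congr 2
    field_simp
  have e3 : ∀ y ∈ Ioi (0:ℝ), ((ENNReal.ofReal (max x y) ^ (-γ)) ^ p⁻¹ *
      ENNReal.ofReal y ^ (p⁻¹ * p'⁻¹) * f y) ^ p =
      ENNReal.ofReal (max x y) ^ (-γ) * ENNReal.ofReal y ^ p'⁻¹ * f y ^ p := by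
    intro y hy
    rw [ENNReal.mul_rpow_of_nonneg _ _ hp0.le, ENNReal.mul_rpow_of_nonneg _ _ hp0.le,
      ENNReal.rpow_inv_rpow hp0.ne', ← ENNReal.rpow_mul]
    congr 3
    field_simp
  rw [setLIntegral_congr_fun measurableSet_Ioi e1, setLIntegral_congr_fun measurableSet_Ioi e2,
    setLIntegral_congr_fun measurableSet_Ioi e3,
    lintegral_max_rpow_mul_rpow (by linarith [hpi']) (by linarith) hx,
    show 1 - γ - p⁻¹ = -q⁻¹ by linarith, one_div p', one_div p] at key
  exact key

/-- Boundedness from `L^p` to `L^q` of the operator with kernel `max(x,y)^{-(1/p'+1/q)}`. -/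
lemma exists_lintegral_max_rpow_rpow_le (hpp : p.HolderConjugate p') (hpq : p ≤ q) :
    ∃ D : ℝ≥0∞, D ≠ ⊤ ∧ ∀ f : ℝ → ℝ≥0∞, Measurable f → ∫⁻ y in Ioi 0, f y ^ p ≠ ⊤ →
      ∫⁻ x in Ioi 0,
          (∫⁻ y in Ioi 0, ENNReal.ofReal (max x y) ^ (-(p'⁻¹ + q⁻¹)) * f y) ^ q ≤
        D * (∫⁻ y in Ioi 0, f y ^ p) ^ (q / p) := by
  have hp0 := hpp.pos
  have hp0' := hpp.symm.pos
  have hq0 : 0 < q := hp0.trans_le hpq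
  have hsum := hpp.inv_add_inv_eq_one
  have hqi : 0 < q⁻¹ := inv_pos.2 hq0
  have hpi : 0 < p⁻¹ := inv_pos.2 hp0
  have hpi' : 0 < p'⁻¹ := inv_pos.2 hp0'
  have hr : 0 ≤ q / p - 1 := by
    rw [sub_nonneg, le_div_iff₀ hp0]; linarith
  set γ := p'⁻¹ + q⁻¹ with hγ
  set c₁ : ℝ≥0∞ := ENNReal.ofReal (1 / (1 - p⁻¹) + 1 / (γ + p⁻¹ - 1)) with hc₁
  set c₂ : ℝ≥0∞ := ENNReal.ofReal (1 / (1 - (1 - q⁻¹)) + 1 / (γ + (1 - q⁻¹) - 1)) with hc₂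
  have hc₁t : c₁ ^ (p'⁻¹ * q) ≠ ⊤ :=
    ENNReal.rpow_ne_top_of_nonneg (by positivity) ENNReal.ofReal_ne_top
  refine ⟨c₁ ^ (p'⁻¹ * q) * c₂, ENNReal.mul_ne_top hc₁t ENNReal.ofReal_ne_top,
    fun f hf hN => ?_⟩
  set N := ∫⁻ y in Ioi 0, f y ^ p with hNdef
  set G : ℝ → ℝ≥0∞ := fun x => ∫⁻ y in Ioi 0, ENNReal.ofReal (max x y) ^ (-γ) *
        ENNReal.ofReal y ^ p'⁻¹ * f y ^ p with hG
  have hGle : ∀ x ∈ Ioi (0:ℝ), G x ≤ ENNReal.ofReal x ^ (-q⁻¹) * N := by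
    intro x hx
    rw [hNdef, ← lintegral_const_mul _ (by fun_prop)]
    refine setLIntegral_mono' measurableSet_Ioi fun y hy => ?_
    gcongr
    have hm : 0 < max x y := lt_max_of_lt_left hx
    calc ENNReal.ofReal (max x y) ^ (-γ) * ENNReal.ofReal y ^ p'⁻¹
        ≤ ENNReal.ofReal (max x y) ^ (-γ) * ENNReal.ofReal (max x y) ^ p'⁻¹ := by
          gcongr; exact le_max_right _ _
      _ = ENNReal.ofReal (max x y) ^ (-q⁻¹) := by
          rw [← ENNReal.rpow_add _ _ (ENNReal.ofReal_pos.2 hm).ne' ENNReal.ofReal_ne_top]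
          congr 1; rw [hγ]; ring
      _ ≤ ENNReal.ofReal x ^ (-q⁻¹) :=
          ENNReal.rpow_neg_le_rpow_neg (ENNReal.ofReal_le_ofReal (le_max_left _ _)) hqi.le
  have hpt : ∀ x ∈ Ioi (0:ℝ),
      (∫⁻ y in Ioi 0, ENNReal.ofReal (max x y) ^ (-γ) * f y) ^ q ≤
        c₁ ^ (p'⁻¹ * q) * N ^ (q / p - 1) * (ENNReal.ofReal x ^ (-(1 - q⁻¹)) * G x) := by
    intro x hx
    have hx0 : ENNReal.ofReal x ≠ 0 := by simpa using hx
    calc (∫⁻ y in Ioi 0, ENNReal.ofReal (max x y) ^ (-γ) * f y) ^ q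
        ≤ ((c₁ * ENNReal.ofReal x ^ (-q⁻¹)) ^ p'⁻¹ * (G x) ^ p⁻¹) ^ q :=
          ENNReal.rpow_le_rpow (lintegral_max_rpow_mul_le hpp hq0 hf hx) hq0.le
      _ = c₁ ^ (p'⁻¹ * q) * ENNReal.ofReal x ^ (-p'⁻¹) * (G x ^ (q / p - 1) * G x) := by
          rw [ENNReal.mul_rpow_of_nonneg _ _ hq0.le, ← ENNReal.rpow_mul, ← ENNReal.rpow_mul,
            ENNReal.mul_rpow_of_nonneg _ _ (by positivity), ← ENNReal.rpow_mul]
          congr 1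
          · congr 2
            field_simp
          · nth_rewrite 3 [← ENNReal.rpow_one (G x)]
            rw [← ENNReal.rpow_add_of_nonneg _ _ hr zero_le_one]
            congr 1
            field_simp
            ring
      _ ≤ c₁ ^ (p'⁻¹ * q) * ENNReal.ofReal x ^ (-p'⁻¹) *
            ((ENNReal.ofReal x ^ (-q⁻¹) * N) ^ (q / p - 1) * G x) := by
          gcongr
          exact hGle x hx
      _ = c₁ ^ (p'⁻¹ * q) * N ^ (q / p - 1) * (ENNReal.ofReal x ^ (-(1 - q⁻¹)) * G x) := by
          have : ENNReal.ofReal x ^ (-(1 - q⁻¹)) =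
              ENNReal.ofReal x ^ (-p'⁻¹) * ENNReal.ofReal x ^ (-q⁻¹ * (q / p - 1)) := by
            rw [← ENNReal.rpow_add _ _ hx0 ENNReal.ofReal_ne_top]
            congr 1
            rw [show p'⁻¹ = 1 - p⁻¹ by linarith]
            field_simp
            ring
          rw [this, ENNReal.mul_rpow_of_nonneg _ _ hr, ← ENNReal.rpow_mul]
          ring
  have hfub : ∫⁻ x in Ioi 0, ENNReal.ofReal x ^ (-(1 - q⁻¹)) * G x = c₂ * N := by
    calc ∫⁻ x in Ioi 0, ENNReal.ofReal x ^ (-(1 - q⁻¹)) * G x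
        = ∫⁻ x in Ioi 0, ∫⁻ y in Ioi 0, ENNReal.ofReal x ^ (-(1 - q⁻¹)) *
            (ENNReal.ofReal (max x y) ^ (-γ) * ENNReal.ofReal y ^ p'⁻¹ * f y ^ p) :=
          lintegral_congr fun x => (lintegral_const_mul _ (by fun_prop)).symm
      _ = ∫⁻ y in Ioi 0, ∫⁻ x in Ioi 0, ENNReal.ofReal x ^ (-(1 - q⁻¹)) *
            (ENNReal.ofReal (max x y) ^ (-γ) * ENNReal.ofReal y ^ p'⁻¹ * f y ^ p) :=
          lintegral_lintegral_swap (by unfold Function.uncurry; fun_prop)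
      _ = ∫⁻ y in Ioi 0, c₂ * f y ^ p := by
          refine setLIntegral_congr_fun measurableSet_Ioi fun y hy => ?_
          have hy0 : ENNReal.ofReal y ≠ 0 := by simpa using hy
          have := lintegral_max_rpow_mul_rpow (a := 1 - q⁻¹) (γ := γ) (by linarith)
            (by linarith) hy
          calc ∫⁻ x in Ioi 0, ENNReal.ofReal x ^ (-(1 - q⁻¹)) *
                (ENNReal.ofReal (max x y) ^ (-γ) * ENNReal.ofReal y ^ p'⁻¹ * f y ^ p)
              = ∫⁻ x in Ioi 0, ENNReal.ofReal y ^ p'⁻¹ * f y ^ p *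
                (ENNReal.ofReal (max y x) ^ (-γ) * ENNReal.ofReal x ^ (-(1 - q⁻¹))) :=
                lintegral_congr fun x => by rw [max_comm]; ring
            _ = c₂ * (ENNReal.ofReal y ^ p'⁻¹ * ENNReal.ofReal y ^ (1 - γ - (1 - q⁻¹))) *
                  f y ^ p := by
                rw [lintegral_const_mul _ (by fun_prop), this]; ring
            _ = c₂ * f y ^ p := by
                rw [← ENNReal.rpow_add _ _ hy0 ENNReal.ofReal_ne_top,
                  show p'⁻¹ + (1 - γ - (1 - q⁻¹)) = 0 by rw [hγ]; ring]
                simp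
      _ = c₂ * N := lintegral_const_mul _ (by fun_prop)
  have hNr : N ^ (q / p - 1) ≠ ⊤ := ENNReal.rpow_ne_top_of_nonneg hr hN
  calc _ ≤ ∫⁻ x in Ioi 0, c₁ ^ (p'⁻¹ * q) * N ^ (q / p - 1) *
          (ENNReal.ofReal x ^ (-(1 - q⁻¹)) * G x) := setLIntegral_mono' measurableSet_Ioi hpt
    _ = c₁ ^ (p'⁻¹ * q) * N ^ (q / p - 1) * (c₂ * N) := by
        rw [lintegral_const_mul' _ _ (ENNReal.mul_ne_top hc₁t hNr), hfub]
    _ = c₁ ^ (p'⁻¹ * q) * c₂ * (N ^ (q / p - 1) * N ^ (1:ℝ)) := by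
        rw [ENNReal.rpow_one]; ring
    _ = c₁ ^ (p'⁻¹ * q) * c₂ * N ^ (q / p) := by
        rw [← ENNReal.rpow_add_of_nonneg _ _ hr zero_le_one, sub_add_cancel]

end MaxKernel

lemma ENNReal.ofReal_half_rpow_neg (γ x : ℝ) :
    ENNReal.ofReal (x / 2) ^ (-γ) =
      ENNReal.ofReal (1 / 2) ^ (-γ) * ENNReal.ofReal x ^ (-γ) := by
  rw [← ENNReal.mul_rpow_of_ne_top ENNReal.ofReal_ne_top ENNReal.ofReal_ne_top,
    ← ENNReal.ofReal_mul (by norm_num)]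
  congr 2
  ring

lemma ENNReal.ofReal_one_half_rpow_ne_top (γ : ℝ) : ENNReal.ofReal (1 / 2) ^ (-γ) ≠ ⊤ := by
  rw [ENNReal.ofReal_rpow_of_pos (by norm_num)]
  exact ENNReal.ofReal_ne_top

lemma iSup_mul_lintegral_rpow_lt_top {g : ℝ → ℝ≥0∞} {M : ℝ≥0∞} (hM : M ≠ ⊤) {γ r s : ℝ}
    (hr : 0 < r) (hs : 0 < s) (hγ : γ * r - 1 = s⁻¹)
    (hg : ∀ x > 0, g x ≤ M * ENNReal.ofReal x ^ (-γ)) :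
    (⨆ x ∈ Ioi (0:ℝ), ENNReal.ofReal x * (∫⁻ y in Ioi x, g y ^ r) ^ s) < ⊤ := by
  have hMr : M ^ r ≠ ⊤ := ENNReal.rpow_ne_top_of_nonneg hr.le hM
  have hsi : 0 < s⁻¹ := inv_pos.2 hs
  set c := M ^ r * ENNReal.ofReal (1 / (γ * r - 1)) with hc
  have hct : c ^ s ≠ ⊤ :=
    ENNReal.rpow_ne_top_of_nonneg hs.le (ENNReal.mul_ne_top hMr ENNReal.ofReal_ne_top)
  refine lt_of_le_of_lt (iSup₂_le fun x hx => ?_) (lt_top_iff_ne_top.2 hct)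
  have hx0 : ENNReal.ofReal x ≠ 0 := (ENNReal.ofReal_pos.2 hx).ne'
  have h1 : ∫⁻ y in Ioi x, g y ^ r ≤ c * ENNReal.ofReal x ^ (-s⁻¹) := by
    calc ∫⁻ y in Ioi x, g y ^ r
        ≤ ∫⁻ y in Ioi x, M ^ r * ENNReal.ofReal y ^ (-(γ * r)) := by
          refine setLIntegral_mono' measurableSet_Ioi fun y hy => ?_
          calc g y ^ r ≤ (M * ENNReal.ofReal y ^ (-γ)) ^ r :=
                ENNReal.rpow_le_rpow (hg y (lt_trans hx hy)) hr.le
            _ = M ^ r * ENNReal.ofReal y ^ (-(γ * r)) := by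
                rw [ENNReal.mul_rpow_of_nonneg _ _ hr.le, ← ENNReal.rpow_mul, neg_mul]
      _ = c * ENNReal.ofReal x ^ (-s⁻¹) := by
          rw [lintegral_const_mul' _ _ hMr, lintegral_Ioi_ofReal_rpow (by linarith) hx, ← mul_assoc,
            ← hγ, neg_sub]
  calc ENNReal.ofReal x * (∫⁻ y in Ioi x, g y ^ r) ^ s
      ≤ ENNReal.ofReal x * (c * ENNReal.ofReal x ^ (-s⁻¹)) ^ s := by gcongr
    _ = c ^ s * (ENNReal.ofReal x * ENNReal.ofReal x ^ (-1 : ℝ)) := by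
        rw [ENNReal.mul_rpow_of_nonneg _ _ hs.le, ← ENNReal.rpow_mul, neg_mul,
          inv_mul_cancel₀ hs.ne']
        ring
    _ = c ^ s := by
        rw [ENNReal.rpow_neg_one, ENNReal.mul_inv_cancel hx0 ENNReal.ofReal_ne_top, mul_one]

lemma exists_le_rpow_of_iSup_mul_lintegral_rpow_lt_top {g : ℝ → ℝ≥0∞}
    (hg : AntitoneOn g (Ioi 0)) {r s : ℝ} (hr : 0 < r) (hs : 0 < s)
    (h : (⨆ x ∈ Ioi (0:ℝ), ENNReal.ofReal x * (∫⁻ y in Ioi x, g y ^ r) ^ s) < ⊤) :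
    ∃ M : ℝ≥0∞, M ≠ ⊤ ∧ ∀ x > 0, g x ≤ M * ENNReal.ofReal x ^ (-((r * s)⁻¹ + r⁻¹)) := by
  set S := ⨆ x ∈ Ioi (0:ℝ), ENNReal.ofReal x * (∫⁻ y in Ioi x, g y ^ r) ^ s
  set γ := (r * s)⁻¹ + r⁻¹ with hγ
  have hrs : 0 < r * s := mul_pos hr hs
  refine ⟨S ^ (r * s)⁻¹ * ENNReal.ofReal (1 / 2) ^ (-γ), ENNReal.mul_ne_top
    (ENNReal.rpow_ne_top_of_nonneg (inv_pos.2 hrs).le h.ne)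
    (ENNReal.ofReal_one_half_rpow_ne_top γ), fun x hx => ?_⟩
  have hx2 : (0:ℝ) < x / 2 := half_pos hx
  have hX0 : ENNReal.ofReal (x / 2) ≠ 0 := (ENNReal.ofReal_pos.2 hx2).ne'
  have h1 : ENNReal.ofReal (x / 2) * (g x ^ r * ENNReal.ofReal (x / 2)) ^ s ≤ S := by
    refine le_trans ?_ (le_iSup₂ (f := fun x (_ : x ∈ Ioi (0:ℝ)) =>
      ENNReal.ofReal x * (∫⁻ y in Ioi x, g y ^ r) ^ s) (x / 2) hx2)
    gcongr
    calc g x ^ r * ENNReal.ofReal (x / 2) = ∫⁻ _ in Ioc (x / 2) x, g x ^ r := by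
          rw [setLIntegral_const, Real.volume_Ioc]; congr 2; ring
      _ ≤ ∫⁻ y in Ioc (x / 2) x, g y ^ r :=
          setLIntegral_mono' measurableSet_Ioc fun y hy =>
            ENNReal.rpow_le_rpow (hg (hx2.trans hy.1) hx hy.2) hr.le
      _ ≤ ∫⁻ y in Ioi (x / 2), g y ^ r := lintegral_mono_set Ioc_subset_Ioi_self
  have h2 : ENNReal.ofReal (x / 2) ^ γ * g x ≤ S ^ (r * s)⁻¹ := by
    rw [ENNReal.le_rpow_inv_iff hrs]
    refine le_trans (le_of_eq ?_) h1
    rw [ENNReal.mul_rpow_of_nonneg _ _ hs.le, ENNReal.mul_rpow_of_nonneg _ _ hrs.le,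
      ← ENNReal.rpow_mul, ← ENNReal.rpow_mul, show γ * (r * s) = 1 + s by rw [hγ]; field_simp,
      ENNReal.rpow_add _ _ hX0 ENNReal.ofReal_ne_top, ENNReal.rpow_one]
    ring
  calc g x = ENNReal.ofReal (x / 2) ^ γ * g x * ENNReal.ofReal (x / 2) ^ (-γ) := by
        rw [mul_right_comm, ← ENNReal.rpow_add _ _ hX0 ENNReal.ofReal_ne_top, add_neg_cancel,
          ENNReal.rpow_zero, one_mul]
    _ ≤ S ^ (r * s)⁻¹ * ENNReal.ofReal (x / 2) ^ (-γ) := by gcongr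
    _ = _ := by rw [ENNReal.ofReal_half_rpow_neg, mul_assoc]

lemma le_rpow_of_radial_bound {p q c : ℝ} (hp : 0 < p) (hq : 0 < q) {k : ℝ → ℝ}
    (hk : AntitoneOn k (Ioi 0))
    (h : ∀ f : ℝ → ℝ≥0∞, Measurable f →
      (∫⁻ x in Ioi (0:ℝ),
          TK (fun x y => ENNReal.ofReal (k (Real.sqrt (x ^ 2 + y ^ 2)))) f x ^ q) ^ (1 / q) ≤
        ENNReal.ofReal c * (∫⁻ y in Ioi (0:ℝ), f y ^ p) ^ (1 / p)) {x : ℝ} (hx : 0 < x) :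
    ENNReal.ofReal (k x) ≤ ENNReal.ofReal c * ENNReal.ofReal (1 / 2) ^ (-(1 - p⁻¹ + q⁻¹)) *
      ENNReal.ofReal x ^ (-(1 - p⁻¹ + q⁻¹)) := by
  obtain ⟨z, rfl⟩ : ∃ z, x = 2 * z := ⟨x / 2, by ring⟩
  have hz : 0 < z := by linarith
  have hZ0 : ENNReal.ofReal z ≠ 0 := (ENNReal.ofReal_pos.2 hz).ne'
  have hT : ∀ t ∈ Ioo 0 z, ENNReal.ofReal (k (2 * z)) * ENNReal.ofReal z ≤
      TK (fun x y => ENNReal.ofReal (k (Real.sqrt (x ^ 2 + y ^ 2)))) ((Ioo 0 z).indicator 1) t := by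
    intro t ht
    calc ENNReal.ofReal (k (2 * z)) * ENNReal.ofReal z
        = ∫⁻ _ in Ioo 0 z, ENNReal.ofReal (k (2 * z)) := by
          rw [setLIntegral_const, Real.volume_Ioo, sub_zero]
      _ ≤ ∫⁻ y in Ioo 0 z, ENNReal.ofReal (k (Real.sqrt (t ^ 2 + y ^ 2))) *
            (Ioo 0 z).indicator 1 y := by
          refine setLIntegral_mono' measurableSet_Ioo fun y hy => ?_
          rw [indicator_of_mem hy, Pi.one_apply, mul_one]
          refine ENNReal.ofReal_le_ofReal (hk ?_ hx ?_)
          · exact Real.sqrt_pos.2 (add_pos (pow_pos ht.1 2) (pow_pos hy.1 2))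
          · rw [Real.sqrt_le_left hx.le]
            nlinarith [ht.1, ht.2, hy.1, hy.2]
      _ ≤ _ := lintegral_mono_set Ioo_subset_Ioi_self
  have hN : ∫⁻ y in Ioi (0:ℝ), ((Ioo 0 z).indicator (1 : ℝ → ℝ≥0∞) y) ^ p =
      ENNReal.ofReal z := by
    have : ∀ y, ((Ioo 0 z).indicator (1 : ℝ → ℝ≥0∞) y) ^ p =
        (Ioo 0 z).indicator (1 : ℝ → ℝ≥0∞) y := fun y => by
      by_cases hy : y ∈ Ioo 0 z <;> simp [hy, hp]
    simp_rw [this]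
    rw [lintegral_indicator_one measurableSet_Ioo, Measure.restrict_apply measurableSet_Ioo,
      inter_eq_left.2 Ioo_subset_Ioi_self, Real.volume_Ioo, sub_zero]
  have h1 := h _ (measurable_one.indicator (measurableSet_Ioo (a := (0:ℝ)) (b := z)))
  rw [hN, one_div, one_div] at h1
  have h2 : ENNReal.ofReal (k (2 * z)) * ENNReal.ofReal z * ENNReal.ofReal z ^ q⁻¹ ≤
      ENNReal.ofReal c * ENNReal.ofReal z ^ p⁻¹ := by
    refine le_trans ?_ h1
    rw [ENNReal.le_rpow_inv_iff hq, ENNReal.mul_rpow_of_nonneg _ _ hq.le,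
      ENNReal.rpow_inv_rpow hq.ne']
    calc (ENNReal.ofReal (k (2 * z)) * ENNReal.ofReal z) ^ q * ENNReal.ofReal z
        = ∫⁻ _ in Ioo 0 z, (ENNReal.ofReal (k (2 * z)) * ENNReal.ofReal z) ^ q := by
          rw [setLIntegral_const, Real.volume_Ioo, sub_zero]
      _ ≤ ∫⁻ t in Ioo 0 z, TK (fun x y => ENNReal.ofReal (k (Real.sqrt (x ^ 2 + y ^ 2))))
            ((Ioo 0 z).indicator 1) t ^ q :=
          setLIntegral_mono' measurableSet_Ioo fun t ht => ENNReal.rpow_le_rpow (hT t ht) hq.le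
      _ ≤ _ := lintegral_mono_set Ioo_subset_Ioi_self
  rw [mul_assoc, ← ENNReal.ofReal_half_rpow_neg, mul_div_cancel_left₀ z two_ne_zero]
  calc ENNReal.ofReal (k (2 * z))
      = ENNReal.ofReal (k (2 * z)) * ENNReal.ofReal z * ENNReal.ofReal z ^ q⁻¹ *
          ENNReal.ofReal z ^ (-(1 + q⁻¹)) := by
        nth_rewrite 1 [← ENNReal.rpow_one (ENNReal.ofReal z)]
        rw [mul_assoc, mul_assoc, ← ENNReal.rpow_add _ _ hZ0 ENNReal.ofReal_ne_top,
          ← ENNReal.rpow_add _ _ hZ0 ENNReal.ofReal_ne_top,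
          show (1:ℝ) + (q⁻¹ + -(1 + q⁻¹)) = 0 by ring, ENNReal.rpow_zero, mul_one]
    _ ≤ ENNReal.ofReal c * ENNReal.ofReal z ^ p⁻¹ * ENNReal.ofReal z ^ (-(1 + q⁻¹)) := by
        gcongr
    _ = ENNReal.ofReal c * ENNReal.ofReal z ^ (-(1 - p⁻¹ + q⁻¹)) := by
        rw [mul_assoc, ← ENNReal.rpow_add _ _ hZ0 ENNReal.ofReal_ne_top]
        congr 2
        ring

lemma exists_radial_bound {p q p' : ℝ} (hpp : p.HolderConjugate p') (hpq : p ≤ q) {k : ℝ → ℝ}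
    {M : ℝ≥0∞} (hM : M ≠ ⊤)
    (hk : ∀ x > 0, ENNReal.ofReal (k x) ≤ M * ENNReal.ofReal x ^ (-(p'⁻¹ + q⁻¹))) :
    ∃ c > 0, ∀ f : ℝ → ℝ≥0∞, Measurable f →
      (∫⁻ x in Ioi (0:ℝ),
          TK (fun x y => ENNReal.ofReal (k (Real.sqrt (x ^ 2 + y ^ 2)))) f x ^ q) ^ (1 / q) ≤
        ENNReal.ofReal c * (∫⁻ y in Ioi (0:ℝ), f y ^ p) ^ (1 / p) := by
  have hp0 := hpp.pos
  have hp0' := hpp.symm.pos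
  have hq0 : 0 < q := hp0.trans_le hpq
  obtain ⟨D, hD, hbound⟩ := exists_lintegral_max_rpow_rpow_le hpp hpq
  have hMq : M ^ q ≠ ⊤ := ENNReal.rpow_ne_top_of_nonneg hq0.le hM
  set E := (M ^ q * D) ^ (1 / q) with hE
  have hEt : E ≠ ⊤ := ENNReal.rpow_ne_top_of_nonneg (by positivity) (ENNReal.mul_ne_top hMq hD)
  refine ⟨E.toReal + 1, by positivity, fun f hf => ?_⟩
  by_cases hN : ∫⁻ y in Ioi (0:ℝ), f y ^ p = ⊤
  · rw [hN, ENNReal.top_rpow_of_pos (by positivity), ENNReal.mul_top]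
    · exact le_top
    · exact (ENNReal.ofReal_pos.2 (by positivity)).ne'
  have hT : ∀ x ∈ Ioi (0:ℝ),
      TK (fun x y => ENNReal.ofReal (k (Real.sqrt (x ^ 2 + y ^ 2)))) f x ≤
        M * ∫⁻ y in Ioi 0, ENNReal.ofReal (max x y) ^ (-(p'⁻¹ + q⁻¹)) * f y := by
    intro x hx
    rw [← lintegral_const_mul' _ _ hM]
    refine setLIntegral_mono' measurableSet_Ioi fun y hy => ?_
    rw [← mul_assoc]
    have hx' : (0:ℝ) < x := hx
    have hy' : (0:ℝ) < y := hy
    gcongr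
    refine (hk _ (Real.sqrt_pos.2 (by positivity))).trans ?_
    refine mul_le_mul' le_rfl (ENNReal.rpow_neg_le_rpow_neg
      (ENNReal.ofReal_le_ofReal (max_le ?_ ?_)) (by positivity))
    · exact Real.le_sqrt_of_sq_le (by nlinarith)
    · exact Real.le_sqrt_of_sq_le (by nlinarith)
  have hle : ∫⁻ x in Ioi (0:ℝ),
      TK (fun x y => ENNReal.ofReal (k (Real.sqrt (x ^ 2 + y ^ 2)))) f x ^ q ≤
        M ^ q * D * (∫⁻ y in Ioi (0:ℝ), f y ^ p) ^ (q / p) := by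
    rw [mul_assoc]
    refine le_trans ?_ (mul_le_mul_right (hbound f hf hN) (M ^ q))
    rw [← lintegral_const_mul' _ _ hMq]
    refine setLIntegral_mono' measurableSet_Ioi fun x hx => ?_
    rw [← ENNReal.mul_rpow_of_nonneg _ _ hq0.le]
    exact ENNReal.rpow_le_rpow (hT x hx) hq0.le
  calc _ ≤ (M ^ q * D * (∫⁻ y in Ioi (0:ℝ), f y ^ p) ^ (q / p)) ^ (1 / q) := by gcongr
    _ = E * (∫⁻ y in Ioi (0:ℝ), f y ^ p) ^ (1 / p) := by
        rw [ENNReal.mul_rpow_of_nonneg _ _ (by positivity), ← ENNReal.rpow_mul]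
        congr 2
        field_simp
    _ ≤ _ := by
        gcongr
        rw [ENNReal.le_ofReal_iff_toReal_le hEt (by positivity)]
        linarith

theorem statement14
    (p q p' : ℝ) (hp : 1 < p) (hpq : p ≤ q) (hp' : p' = p / (p - 1))
    (k : ℝ → ℝ) (hkmeas : Measurable k) (hknn : ∀ t > 0, 0 ≤ k t)
    (hkmono : AntitoneOn k (Ioi 0))
    (C : ℝ) (hC : 0 < C) (hdouble : ∀ t > 0, k (t / 2) ≤ C * k t)
    (hloc : ∀ a > 0, ∀ x > 0,
      (∫⁻ y in Ioo (0:ℝ) a, ENNReal.ofReal (k (Real.sqrt (x ^ 2 + y ^ 2)))) < ⊤) :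
    (∃ c > 0, ∀ f : ℝ → ℝ≥0∞, Measurable f →
      (∫⁻ x in Ioi (0:ℝ),
          TK (fun x y => ENNReal.ofReal (k (Real.sqrt (x ^ 2 + y ^ 2)))) f x ^ q) ^ (1 / q) ≤
        ENNReal.ofReal c * (∫⁻ y in Ioi (0:ℝ), f y ^ p) ^ (1 / p)) ↔
    ((⨆ x ∈ Ioi (0:ℝ),
        ENNReal.ofReal x * (∫⁻ y in Ioi x, ENNReal.ofReal (k y) ^ q) ^ (p' / q)) < ⊤ ∧
      (⨆ x ∈ Ioi (0:ℝ),
        ENNReal.ofReal x * (∫⁻ y in Ioi x, ENNReal.ofReal (k y) ^ p') ^ (q / p')) < ⊤) := by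
  have hp0 : 0 < p := one_pos.trans hp
  have hq0 : 0 < q := hp0.trans_le hpq
  have hpp : p.HolderConjugate p' := by
    rw [hp']
    exact Real.HolderConjugate.conjExponent hp
  have hp0' := hpp.symm.pos
  have hsum := hpp.inv_add_inv_eq_one
  have hγ : 1 - p⁻¹ + q⁻¹ = p'⁻¹ + q⁻¹ := by linarith
  constructor
  · rintro ⟨c, -, h⟩
    have hdecay : ∀ x > 0, ENNReal.ofReal (k x) ≤
        ENNReal.ofReal c * ENNReal.ofReal (1 / 2) ^ (-(p'⁻¹ + q⁻¹)) *
          ENNReal.ofReal x ^ (-(p'⁻¹ + q⁻¹)) := fun x hx => by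
      simpa only [hγ] using le_rpow_of_radial_bound hp0 hq0 hkmono h hx
    have hM := ENNReal.mul_ne_top (ENNReal.ofReal_ne_top (r := c))
      (ENNReal.ofReal_one_half_rpow_ne_top (p'⁻¹ + q⁻¹))
    constructor
    · refine iSup_mul_lintegral_rpow_lt_top hM hq0 (div_pos hp0' hq0) ?_ hdecay
      field_simp
      ring
    · refine iSup_mul_lintegral_rpow_lt_top hM hp0' (div_pos hq0 hp0') ?_ hdecay
      field_simp
      ring
  · rintro ⟨h, -⟩
    have hanti : AntitoneOn (fun x => ENNReal.ofReal (k x)) (Ioi 0) :=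
      fun x hx y hy hxy => ENNReal.ofReal_le_ofReal (hkmono hx hy hxy)
    obtain ⟨M, hM, hk⟩ := exists_le_rpow_of_iSup_mul_lintegral_rpow_lt_top hanti hq0
      (div_pos hp0' hq0) h
    rw [mul_div_cancel₀ p' hq0.ne'] at hk
    exact exists_radial_bound hpp hpq hM hk

end
end
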